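/- arXiv:2407.16075 — 2 statements merged into one kernel-verified Lean document; each statement's English description precedes it below -/
import Mathlib

section
/- Let $a_1, \dots, a_k$ be complex numbers and $n_1 < n_2 < \dots < n_k$ integers. Then $\int_0^1 \left|\sum_{j=1}^k a_j e^{2\pi i n_j t}\right| dt \geq c \sum_{j=1}^k \frac{|a_j|}{j}$ for an absolute constant $c > 0$. -/
open Real

namespace LW
open MeasureTheory AddCircle ComplexConjugate

abbrev T := AddCircle (1:ℝ)
abbrev CT := C(AddCircle (1:ℝ), ℂ)

noncomputable abbrev mu : Measure T := haarAddCircle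

theorem integ {E : Type*} [NormedAddCommGroup E] {g : T → E} (hg : Continuous g) :
    Integrable g mu :=
  hg.integrable_of_hasCompactSupport (HasCompactSupport.of_compactSpace g)

noncomputable def I : CT →L[ℂ] ℂ :=
  LinearMap.mkContinuous
    { toFun := fun g => ∫ t, g t ∂mu
      map_add' := fun f g => by
        simpa using integral_add (integ f.continuous) (integ g.continuous)
      map_smul' := fun c g => by
        simpa using integral_const_mul (μ := mu) c (fun t => g t) } 1 (fun g => by
      have := norm_integral_le_of_norm_le_const (μ := mu) (f := fun t => g t)
        (Filter.Eventually.of_forall (fun t => g.norm_coe_le_norm t))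
      simpa using this)

theorem I_apply (g : CT) : I g = ∫ t, g t ∂mu := rfl

theorem norm_I_le (g : CT) : ‖I g‖ ≤ ∫ t, ‖g t‖ ∂mu := norm_integral_le_integral_norm _

theorem fourier_mul (m n : ℤ) : (fourier m * fourier n : CT) = fourier (m + n) := by
  ext t; simp

theorem I_fourier (n : ℤ) : I (fourier n) = if n = 0 then 1 else 0 := by
  split_ifs with h
  · subst h; simp [I_apply]
  · rw [I_apply]
    have h2 := integral_eq_zero_of_add_right_eq_neg (μ := mu)
      (fun t => fourier_add_half_inv_index h (by norm_num : (0:ℝ) < 1) t)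
    exact h2

noncomputable abbrev z : CT := fourier (-1)

theorem z_pow (k : ℕ) : z ^ k = fourier (-(k:ℤ)) := by
  induction k with
  | zero => ext t; simp
  | succ k ih => rw [pow_succ, ih, fourier_mul]; congr 1; push_cast; ring

theorem I_aeval (P : Polynomial ℂ) : I (Polynomial.aeval z P) = P.coeff 0 := by
  induction P using Polynomial.induction_on' with
  | add p q hp hq => simp [hp, hq]
  | monomial k c =>
    rw [Polynomial.aeval_monomial, ← Algebra.smul_def, map_smul, z_pow, I_fourier,
      Polynomial.coeff_monomial]
    simp

noncomputable def A : Subalgebra ℂ CT := (Polynomial.aeval (R := ℂ) z).range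

theorem hardy {m : ℤ} (hm : 0 < m) {g : CT} (hg : g ∈ A.topologicalClosure) :
    I (fourier (-m) * g) = 0 := by
  have hcl : IsClosed {g : CT | I (fourier (-m) * g) = 0} :=
    isClosed_eq (by fun_prop) continuous_const
  refine closure_minimal (s := (A : Set CT)) ?_ hcl hg
  rintro _ ⟨P, rfl⟩
  obtain ⟨k, rfl⟩ := Int.eq_ofNat_of_zero_le hm.le
  have hk : 0 < k := by omega
  change I (fourier (-(k:ℤ)) * Polynomial.aeval z P) = 0
  have : (fourier (-(k:ℤ)) : CT) * Polynomial.aeval z P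
      = Polynomial.aeval z (Polynomial.X ^ k * P) := by
    rw [map_mul, map_pow, Polynomial.aeval_X, z_pow]
  rw [this, I_aeval, Polynomial.coeff_X_pow_mul', if_neg (by omega)]

theorem exists_poly {g : CT} (hg : g ∈ Submodule.span ℂ (Set.range (fourier : ℤ → CT))) :
    ∃ P Q : Polynomial ℂ, g = Polynomial.aeval z P + star (Polynomial.aeval z Q) := by
  induction hg using Submodule.span_induction with
  | mem x hx =>
    obtain ⟨n, rfl⟩ := hx
    rcases le_total n 0 with h | h
    · obtain ⟨k, hk⟩ := Int.eq_ofNat_of_zero_le (neg_nonneg.2 h)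
      refine ⟨Polynomial.X ^ k, 0, ?_⟩
      simp only [map_pow, Polynomial.aeval_X, z_pow, ← Int.ofNat_eq_natCast] 
      simp [← hk]
    · obtain ⟨k, rfl⟩ := Int.eq_ofNat_of_zero_le h
      refine ⟨0, Polynomial.X ^ k, ?_⟩
      simp only [map_pow, Polynomial.aeval_X, z_pow]
      ext t
      simp only [ContinuousMap.add_apply, ContinuousMap.star_apply, fourier_neg]
      simp
  | zero => exact ⟨0, 0, by simp⟩
  | add x y _ _ hx hy =>
    obtain ⟨P, Q, rfl⟩ := hx
    obtain ⟨P', Q', rfl⟩ := hy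
    exact ⟨P + P', Q + Q', by simp; abel⟩
  | smul c x _ hx =>
    obtain ⟨P, Q, rfl⟩ := hx
    exact ⟨c • P, conj c • Q, by simp [smul_add]⟩

theorem exists_h (u : C(T, ℝ)) {ε : ℝ} (hε : 0 < ε) : ∃ h ∈ A,
    (∀ t, u t ≤ (h t).re) ∧ (∀ t, (h t).re ≤ u t + ε) ∧
      ∫ t, ‖h t‖ ^ 2 ∂mu ≤ 2 * ∫ t, (h t).re ^ 2 ∂mu := by
  let U : CT := ⟨fun t => ((u t + ε / 2 : ℝ) : ℂ), by fun_prop⟩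
  have hU : U ∈ closure (Submodule.span ℂ (Set.range (fourier : ℤ → CT)) : Set CT) := by
    have := span_fourier_closure_eq_top (T := (1:ℝ))
    have h2 : U ∈ (Submodule.span ℂ (Set.range (fourier : ℤ → CT))).topologicalClosure := by
      rw [this]; trivial
    exact h2
  obtain ⟨g, hg, hUg⟩ := Metric.mem_closure_iff.1 hU (ε / 2) (by positivity)
  obtain ⟨P, Q, rfl⟩ := exists_poly hg
  let R : Polynomial ℂ := P + Q - Polynomial.C (((P + Q).coeff 0).im * Complex.I)
  have hre : ∀ t, (Polynomial.aeval z R t).re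
      = ((Polynomial.aeval z P + star (Polynomial.aeval z Q) : CT) t).re := by
    intro t
    have : algebraMap ℂ CT (((P + Q).coeff 0).im * Complex.I) t
      = (((P + Q).coeff 0).im * Complex.I) := by simp 
    simp only [R, map_sub, map_add, Polynomial.aeval_C, ContinuousMap.sub_apply,
      ContinuousMap.add_apply, ContinuousMap.star_apply, Complex.sub_re, Complex.add_re, this]
    simp
  have hclose : ∀ t, |u t + ε / 2 - (Polynomial.aeval z R t).re| < ε / 2 := by
    intro t
    rw [hre]
    have h1 := (ContinuousMap.dist_apply_le_dist (f := U) t).trans_lt hUg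
    rw [Complex.dist_eq] at h1
    refine lt_of_le_of_lt ?_ h1
    have := Complex.abs_re_le_norm (U t - (Polynomial.aeval z P + star (Polynomial.aeval z Q) : CT) t)
    rw [Complex.sub_re] at this
    exact this
  refine ⟨Polynomial.aeval z R, ⟨R, rfl⟩, fun t => ?_, fun t => ?_, ?_⟩
  · have := abs_lt.1 (hclose t); linarith
  · have := abs_lt.1 (hclose t); linarith
  · set h : CT := Polynomial.aeval z R with hh
    have h0 : I (h * h) = (R.coeff 0) ^ 2 := by
      rw [hh, ← map_mul, I_aeval, Polynomial.mul_coeff_zero, sq]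
    have him : (R.coeff 0).im = 0 := by simp [R]
    have h1 : 0 ≤ (I (h * h)).re := by
      rw [h0, sq, Complex.mul_re, him]; nlinarith [sq_nonneg (R.coeff 0).re]
    have h2 : (I (h * h)).re = ∫ t, (h t * h t).re ∂mu := by
      rw [I_apply]
      exact (integral_re (𝕜 := ℂ) (integ (h * h).continuous)).symm
    have h3 : ∫ t, ‖h t‖ ^ 2 ∂mu = 2 * ∫ t, (h t).re ^ 2 ∂mu - ∫ t, (h t * h t).re ∂mu := by
      rw [← integral_const_mul, ← integral_sub (integ (by fun_prop)) (integ (by fun_prop))]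
      congr 1; ext t
      rw [Complex.sq_norm, Complex.normSq_apply, Complex.mul_re]; ring
    linarith

theorem norm_exp_sub_one {w : ℂ} (hw : w.re ≤ 0) : ‖Complex.exp w - 1‖ ≤ 2 * ‖w‖ := by
  rcases le_total ‖w‖ 1 with h | h
  · exact Complex.norm_exp_sub_one_le h
  · have : ‖Complex.exp w‖ ≤ 1 := by rw [Complex.norm_exp]; exact Real.exp_le_one_iff.2 hw
    have h2 := norm_sub_le (Complex.exp w) 1
    simp at h2; linarith

theorem exp_apply (g : CT) (t : T) : (NormedSpace.exp g : CT) t = Complex.exp (g t) := by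
  have := NormedSpace.map_exp (ContinuousMap.evalAlgHom ℂ ℂ t : CT →ₐ[ℂ] ℂ)
    (by exact continuous_eval_const t) g
  rw [Complex.exp_eq_exp_ℂ]
  exact this

theorem exp_mem_A {g : CT} (hg : g ∈ A) : NormedSpace.exp g ∈ A.topologicalClosure :=
  NormedSpace.exp_mem (R := ℂ) A.isClosed_topologicalClosure (A.le_topologicalClosure hg)


noncomputable def G (h : ℕ → CT) (j J : ℕ) : CT :=
  NormedSpace.exp ((-(1/100) : ℂ) • ∑ i ∈ Finset.Ico (j+1) J, h i)

noncomputable def F (f h : ℕ → CT) (J : ℕ) : CT := ∑ j ∈ Finset.range J, f j * G h j J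

theorem G_apply (h : ℕ → CT) (j J : ℕ) (t : T) :
    G h j J t = Complex.exp ((-(1/100) : ℂ) * ∑ i ∈ Finset.Ico (j+1) J, h i t) := by
  rw [G, exp_apply]; simp

theorem F_succ (f h : ℕ → CT) (J : ℕ) (t : T) :
    F f h (J+1) t = F f h J t * Complex.exp (-(1/100) * h J t) + f J t := by
  simp only [F, ContinuousMap.sum_apply, ContinuousMap.mul_apply, G_apply]
  rw [Finset.sum_range_succ, Finset.sum_mul]
  congr 1
  · refine Finset.sum_congr rfl fun j hj => ?_
    have hj := Finset.mem_range.1 hj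
    rw [Finset.sum_Ico_succ_top (by omega), mul_add, Complex.exp_add, mul_assoc]
  · simp

noncomputable def C0 : ℝ := 1 / (1 - Real.exp (-(1/100)))

theorem C0_den : 0 < 1 - Real.exp (-(1/100)) := by
  have : Real.exp (-(1/100)) < 1 := by
    rw [← Real.exp_zero]; exact Real.exp_lt_exp.2 (by norm_num)
  linarith

theorem C0_pos : 0 < C0 := one_div_pos.2 C0_den

theorem real_ineq {y : ℝ} (h0 : 0 ≤ y) (h1 : y ≤ 1) :
    C0 * Real.exp (-(1/100) * y) + y ≤ C0 := by
  have hc := convexOn_exp.2 (Set.mem_univ (0:ℝ)) (Set.mem_univ (-(1/100):ℝ))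
    (sub_nonneg.2 h1) h0 (by ring)
  simp only [smul_eq_mul, mul_zero, zero_add, Real.exp_zero, mul_one] at hc
  rw [mul_comm y (-(1/100))] at hc
  have h2 : C0 * (1 - Real.exp (-(1/100))) = 1 := by
    rw [C0]; exact one_div_mul_cancel C0_den.ne'
  have h3 := mul_le_mul_of_nonneg_left hc C0_pos.le
  have : C0 * (1 - y + y * Real.exp (-(1/100))) = C0 - y * (C0 * (1 - Real.exp (-(1/100)))) := by
    ring
  rw [this, h2] at h3
  linarith

theorem F_bound {f h : ℕ → CT} (h1 : ∀ i t, ‖f i t‖ ≤ 1) (h2 : ∀ i t, ‖f i t‖ ≤ (h i t).re)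
    (J : ℕ) (t : T) : ‖F f h J t‖ ≤ C0 := by
  induction J with
  | zero => simp [F, C0_pos.le]
  | succ J ih =>
    rw [F_succ]
    refine (norm_add_le _ _).trans ?_
    rw [norm_mul, Complex.norm_exp]
    have e : ((-(1/100) : ℂ) * h J t).re = -(1/100) * (h J t).re := by
      have : (-(1/100) : ℂ) = ((-(1/100) : ℝ) : ℂ) := by push_cast; rfl
      rw [this, Complex.re_ofReal_mul]
    rw [e]
    have : Real.exp (-(1/100) * (h J t).re) ≤ Real.exp (-(1/100) * ‖f J t‖) :=
      Real.exp_le_exp.2 (by linarith [h2 J t])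
    refine le_trans ?_ (real_ineq (norm_nonneg (f J t)) (h1 J t))
    gcongr
    exact C0_pos.le

theorem cs {f h : CT} {i j : ℕ} (hf : ∫ t, ‖f t‖ ^ 2 ∂mu ≤ (1/4) ^ j)
    (hh : ∫ t, ‖h t‖ ^ 2 ∂mu ≤ 8 * (1/4) ^ i) :
    ∫ t, ‖f t‖ * ‖h t‖ ∂mu ≤ 5 * ((1/2) ^ i * (1/2) ^ j) := by
  set p : ℝ := (1/2) ^ i with hp
  set q : ℝ := (1/2) ^ j with hq
  have hp0 : 0 < p := by positivity
  have hq0 : 0 < q := by positivity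
  have hp2 : ((1:ℝ)/4) ^ i = p ^ 2 := by rw [hp, ← pow_mul, mul_comm, pow_mul]; norm_num
  have hq2 : ((1:ℝ)/4) ^ j = q ^ 2 := by rw [hq, ← pow_mul, mul_comm, pow_mul]; norm_num
  rw [hq2] at hf
  rw [hp2] at hh
  have h1 : ∫ t, ‖f t‖ * ‖h t‖ ∂mu ≤ ∫ t, (p / (2 * q) * ‖f t‖ ^ 2 + q / (2 * p) * ‖h t‖ ^ 2) ∂mu := by
    refine integral_mono (integ (by fun_prop)) (integ (by fun_prop)) fun t => ?_
    have : p / (2 * q) * ‖f t‖ ^ 2 + q / (2 * p) * ‖h t‖ ^ 2 - ‖f t‖ * ‖h t‖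
      = (p * ‖f t‖ - q * ‖h t‖) ^ 2 / (2 * p * q) := by field_simp; ring
    have h2 : 0 ≤ (p * ‖f t‖ - q * ‖h t‖) ^ 2 / (2 * p * q) := by positivity
    simp only; linarith
  rw [integral_add (integ (by fun_prop)) (integ (by fun_prop)), integral_const_mul,
    integral_const_mul] at h1
  have h2 : p / (2 * q) * ∫ t, ‖f t‖ ^ 2 ∂mu ≤ p / (2 * q) * q ^ 2 := by gcongr
  have h3 : q / (2 * p) * ∫ t, ‖h t‖ ^ 2 ∂mu ≤ q / (2 * p) * (8 * p ^ 2) := by gcongr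
  have h4 : p / (2 * q) * q ^ 2 = p * q / 2 := by field_simp
  have h5 : q / (2 * p) * (8 * p ^ 2) = 4 * (p * q) := by field_simp; ring
  nlinarith [mul_pos hp0 hq0]

theorem err {f h : ℕ → CT} (h2 : ∀ i t, ‖f i t‖ ≤ (h i t).re)
    (hf : ∀ i, ∫ t, ‖f i t‖ ^ 2 ∂mu ≤ (1/4) ^ i)
    (hh : ∀ i, ∫ t, ‖h i t‖ ^ 2 ∂mu ≤ 8 * (1/4) ^ i) (m : ℤ) (j J : ℕ) :
    ‖I (fourier (-m) * (f j * (G h j J - 1)))‖ ≤ (1/10) * (1/4) ^ j := by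
  refine (norm_I_le _).trans ?_
  have hb : ∀ t, ‖(fourier (-m) * (f j * (G h j J - 1)) : CT) t‖
      ≤ (1/50) * ∑ i ∈ Finset.Ico (j+1) J, ‖f j t‖ * ‖h i t‖ := by
    intro t
    simp only [ContinuousMap.mul_apply, ContinuousMap.sub_apply, ContinuousMap.one_apply, norm_mul,
      G_apply]
    have e1 : ‖(fourier (-m) : CT) t‖ = 1 := by rw [fourier_apply]; exact Circle.norm_coe _
    rw [e1, one_mul, ← Finset.mul_sum]
    set S := ∑ i ∈ Finset.Ico (j+1) J, h i t
    have e2 : ((-(1/100) : ℂ) * S).re = -(1/100) * S.re := by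
      have : (-(1/100) : ℂ) = ((-(1/100) : ℝ) : ℂ) := by push_cast; rfl
      rw [this, Complex.re_ofReal_mul]
    have hS : 0 ≤ S.re := by
      rw [Complex.re_sum]
      exact Finset.sum_nonneg fun i _ => (norm_nonneg _).trans (h2 i t)
    have e3 := norm_exp_sub_one (w := (-(1/100) : ℂ) * S) (by rw [e2]; linarith)
    have e4 : ‖(-(1/100) : ℂ) * S‖ = 1/100 * ‖S‖ := by
      rw [norm_mul]; norm_num
    have e5 : ‖S‖ ≤ ∑ i ∈ Finset.Ico (j+1) J, ‖h i t‖ := norm_sum_le _ _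
    calc _ ≤ ‖f j t‖ * ((1/50) * ∑ i ∈ Finset.Ico (j+1) J, ‖h i t‖) := by
          gcongr; rw [e4] at e3; linarith
      _ = _ := by ring
  have h3 : ∫ t, ‖(fourier (-m) * (f j * (G h j J - 1)) : CT) t‖ ∂mu
      ≤ ∫ t, (1/50) * ∑ i ∈ Finset.Ico (j+1) J, ‖f j t‖ * ‖h i t‖ ∂mu :=
    integral_mono (integ (by fun_prop)) (integ (by fun_prop)) hb
  refine h3.trans ?_
  rw [integral_const_mul, integral_finsetSum _ (fun i _ => integ (by fun_prop))]
  have h4 : ∑ i ∈ Finset.Ico (j+1) J, ∫ t, ‖f j t‖ * ‖h i t‖ ∂mu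
      ≤ ∑ i ∈ Finset.Ico (j+1) J, 5 * ((1/2) ^ i * (1/2) ^ j) :=
    Finset.sum_le_sum fun i _ => cs (hf j) (hh i)
  have h5 : ∑ i ∈ Finset.Ico (j+1) J, 5 * (((1:ℝ)/2) ^ i * (1/2) ^ j)
      = 5 * (1/2) ^ j * ∑ i ∈ Finset.Ico (j+1) J, ((1:ℝ)/2) ^ i := by
    rw [Finset.mul_sum]; exact Finset.sum_congr rfl fun i _ => by ring
  have h6 := geom_sum_Ico_le_of_lt_one (x := (1:ℝ)/2) (m := j+1) (n := J) (by norm_num) (by norm_num)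
  have h7 : ((1:ℝ)/2) ^ (j+1) / (1 - 1/2) = (1/2) ^ j := by rw [pow_succ]; ring
  rw [h7] at h6
  have h8 : ((1:ℝ)/4) ^ j = (1/2) ^ j * (1/2) ^ j := by rw [← mul_pow]; norm_num
  have h9 : 5 * ((1:ℝ)/2) ^ j * ∑ i ∈ Finset.Ico (j+1) J, ((1:ℝ)/2) ^ i
      ≤ 5 * (1/2) ^ j * (1/2) ^ j := by gcongr
  rw [h8]; linarith

theorem coeff_est {f h : ℕ → CT} (hA : ∀ i, h i ∈ A) (h2 : ∀ i t, ‖f i t‖ ≤ (h i t).re)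
    (hf : ∀ i, ∫ t, ‖f i t‖ ^ 2 ∂mu ≤ (1/4) ^ i)
    (hh : ∀ i, ∫ t, ‖h i t‖ ^ 2 ∂mu ≤ 8 * (1/4) ^ i) (m : ℤ) (l J : ℕ) (hl : l < J) (c : ℂ)
    (hc : ∀ j, I (fourier (-m) * f j) = if j = l then c else 0)
    (hz : ∀ j < l, ∀ g ∈ A.topologicalClosure, I (fourier (-m) * (f j * g)) = 0) :
    ‖I (fourier (-m) * F f h J) - c‖ ≤ (1/6) * (1/4) ^ l := by
  have hG : ∀ j, G h j J ∈ A.topologicalClosure := fun j =>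
    exp_mem_A (A.smul_mem (A.sum_mem fun i _ => hA i) _)
  have e1 : I (fourier (-m) * F f h J) - c
      = ∑ j ∈ Finset.Ico l J, I (fourier (-m) * (f j * (G h j J - 1))) := by
    have : ∀ j, I (fourier (-m) * (f j * (G h j J - 1)))
      = I (fourier (-m) * (f j * G h j J)) - if j = l then c else 0 := by
      intro j
      rw [← hc, ← map_sub]; congr 1; ring
    rw [Finset.sum_congr rfl fun j _ => this j, Finset.sum_sub_distrib, F, Finset.mul_sum, map_sum,
      Finset.sum_ite_eq' , if_pos (Finset.mem_Ico.2 ⟨le_rfl, hl⟩),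
      ← Finset.sum_range_add_sum_Ico _ hl.le,
      Finset.sum_eq_zero fun j hj => hz j (Finset.mem_range.1 hj) _ (hG j), zero_add]
  rw [e1]
  refine (norm_sum_le _ _).trans ((Finset.sum_le_sum fun j _ => err h2 hf hh m j J).trans ?_)
  rw [← Finset.mul_sum]
  have h6 := geom_sum_Ico_le_of_lt_one (x := (1:ℝ)/4) (m := l) (n := J) (by norm_num) (by norm_num)
  have : (0:ℝ) < (1/4) ^ l := by positivity
  have h7 : ((1:ℝ)/4) ^ l / (1 - 1/4) = 4/3 * (1/4) ^ l := by ring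
  rw [h7] at h6
  linarith

theorem I_trig {ι : Type*} [DecidableEq ι] (s : Finset ι) (a : ι → ℂ) (n : ι → ℤ)
    (hn : Function.Injective n) (k : ι) :
    I (fourier (-(n k)) * ∑ j ∈ s, a j • fourier (n j)) = if k ∈ s then a k else 0 := by
  rw [Finset.mul_sum, map_sum]
  have : ∀ j ∈ s, I (fourier (-(n k)) * (a j • fourier (n j))) = if k = j then a j else 0 := by
    intro j _
    rw [mul_smul_comm, map_smul, fourier_mul, I_fourier]
    by_cases h : k = j
    · subst h; simp
    · have : -(n k) + n j ≠ 0 := fun h' => h (hn (by omega))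
      simp [h, this]
  rw [Finset.sum_congr rfl this]; simp

theorem I_pair {ι : Type*} (s : Finset ι) (a : ι → ℂ) (n : ι → ℤ) (g : CT) :
    I ((∑ j ∈ s, a j • fourier (n j)) * star g) = ∑ j ∈ s, a j * conj (I (fourier (-(n j)) * g)) := by
  rw [Finset.sum_mul, map_sum]
  refine Finset.sum_congr rfl fun j _ => ?_
  rw [smul_mul_assoc, map_smul, smul_eq_mul, I_apply, I_apply, ← integral_conj]
  congr 2; ext t
  simp only [ContinuousMap.mul_apply, ContinuousMap.star_apply, map_mul, fourier_neg, Complex.conj_conj]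
  rfl

theorem parseval {ι : Type*} [DecidableEq ι] (s : Finset ι) (a : ι → ℂ) (n : ι → ℤ)
    (hn : Function.Injective n) :
    ∫ t, ‖(∑ j ∈ s, a j • fourier (n j) : CT) t‖ ^ 2 ∂mu = ∑ j ∈ s, ‖a j‖ ^ 2 := by
  have h := I_pair s a n (∑ j ∈ s, a j • fourier (n j))
  simp only [I_trig s a n hn] at h
  have h2 : ∑ j ∈ s, a j * conj (if j ∈ s then a j else 0) = ((∑ j ∈ s, ‖a j‖ ^ 2 : ℝ) : ℂ) := by
    push_cast
    refine Finset.sum_congr rfl fun j hj => ?_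
    rw [if_pos hj, Complex.mul_conj, Complex.normSq_eq_norm_sq]; push_cast; rfl
  rw [h2, I_apply] at h
  have h3 : ∀ t, ((∑ j ∈ s, a j • fourier (n j)) * star (∑ j ∈ s, a j • fourier (n j)) : CT) t
    = ((‖(∑ j ∈ s, a j • fourier (n j) : CT) t‖ ^ 2 : ℝ) : ℂ) := by
    intro t
    rw [ContinuousMap.mul_apply, ContinuousMap.star_apply, Complex.star_def, Complex.mul_conj,
      Complex.normSq_eq_norm_sq]
  simp only [h3] at h
  rw [integral_complex_ofReal] at h
  exact_mod_cast h

theorem main_circle (k : ℕ) (a : Fin k → ℂ) (n : Fin k → ℤ) (hn : StrictMono n) :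
    (1 / (6 * C0)) * ∑ j : Fin k, ‖a j‖ / ((j : ℕ) + 1) ≤
      ∫ t, ‖(∑ j : Fin k, a j • fourier (n j) : CT) t‖ ∂mu := by
  let b : Fin k → ℕ := fun j => Nat.log 4 (j + 1)
  let w : Fin k → ℂ := fun j => a j / ‖a j‖ * ((1/3) * (1/4) ^ (b j))
  let s : ℕ → Finset (Fin k) := fun l => Finset.univ.filter fun j => b j = l
  let f : ℕ → CT := fun l => ∑ j ∈ s l, w j • fourier (n j)
  have hw : ∀ l, ∀ j ∈ s l, ‖w j‖ ≤ (1/3) * (1/4) ^ l := by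
    intro l j hj
    have : b j = l := (Finset.mem_filter.1 hj).2
    subst this
    simp only [w, norm_mul, norm_div, norm_pow]
    have : ‖a j‖ / ‖((‖a j‖ : ℝ) : ℂ)‖ ≤ 1 := by
      rw [Complex.norm_real, norm_norm]; exact div_self_le_one _
    have e3 : ‖(1:ℂ)‖ / ‖(3:ℂ)‖ = 1/3 := by norm_num
    have e4 : ‖(1:ℂ)‖ / ‖(4:ℂ)‖ = 1/4 := by norm_num
    rw [e3, e4]
    exact mul_le_of_le_one_left (by positivity) this
  have hcard : ∀ l, ((s l).card : ℝ) ≤ 3 * 4 ^ l := by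
    intro l
    have h1 : (s l).card ≤ (Finset.Ico (4 ^ l) (4 ^ (l+1))).card := by
      refine Finset.card_le_card_of_injOn (fun j => (j:ℕ) + 1) ?_ ?_
      · intro j hj
        have hj : Nat.log 4 ((j:ℕ) + 1) = l := (Finset.mem_filter.1 hj).2
        have := (Nat.log_eq_iff (b := 4) (m := l) (n := j + 1) (Or.inr ⟨by norm_num, by omega⟩)).1 hj
        simpa using this
      · intro i _ j _ hij
        exact Fin.ext (by simpa using hij)
    rw [Nat.card_Ico, pow_succ] at h1
    have : (s l).card ≤ 3 * 4 ^ l := by omega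
    exact_mod_cast this
  have hpow : ∀ l : ℕ, ((4:ℝ)) ^ l * (1/4) ^ l = 1 := by
    intro l; rw [← mul_pow]; norm_num
  have h1 : ∀ i t, ‖f i t‖ ≤ 1 := by
    intro i t
    simp only [f, ContinuousMap.sum_apply, ContinuousMap.smul_apply]
    refine (norm_sum_le_of_le _ (f := fun j => w j • (fourier (n j) : CT) t)
      (n := fun _ => (1/3) * (1/4) ^ i) fun j hj => ?_).trans ?_
    · have e1 : ‖(fourier (n j) : CT) t‖ = 1 := by rw [fourier_apply]; exact Circle.norm_coe _
      rw [norm_smul, e1, mul_one]; exact hw i j hj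
    · rw [Finset.sum_const, nsmul_eq_mul]
      calc _ ≤ 3 * (4:ℝ) ^ i * ((1/3) * (1/4) ^ i) := by gcongr; exact hcard i
        _ = 4 ^ i * (1/4) ^ i := by ring
        _ ≤ 1 := (hpow i).le
  have hf : ∀ i, ∫ t, ‖f i t‖ ^ 2 ∂mu ≤ (1/4) ^ i := by
    intro i
    rw [parseval (s i) w n hn.injective]
    calc _ ≤ ∑ j ∈ s i, (((1:ℝ)/3) * (1/4) ^ i) ^ 2 :=
          Finset.sum_le_sum fun j hj => by gcongr; exact hw i j hj
      _ = (s i).card * (((1:ℝ)/3) * (1/4) ^ i) ^ 2 := by rw [Finset.sum_const, nsmul_eq_mul]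
      _ ≤ 3 * 4 ^ i * (((1:ℝ)/3) * (1/4) ^ i) ^ 2 := by gcongr; exact hcard i
      _ = (1/3) * (1/4) ^ i * (4 ^ i * (1/4) ^ i) := by ring
      _ ≤ _ := by rw [hpow]; have : (0:ℝ) < (1/4) ^ i := by positivity
                  linarith
  have hex : ∀ i, ∃ h ∈ A, (∀ t, ‖f i t‖ ≤ (h t).re) ∧ ∫ t, ‖h t‖ ^ 2 ∂mu ≤ 8 * (1/4) ^ i := by
    intro i
    obtain ⟨h, hA, ha, hb, hc⟩ := exists_h ⟨fun t => ‖f i t‖, by fun_prop⟩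
      (ε := (1/2) ^ i) (by positivity)
    refine ⟨h, hA, ha, hc.trans ?_⟩
    have h4 : ∫ t, (h t).re ^ 2 ∂mu ≤ ∫ t, (2 * ‖f i t‖ ^ 2 + 2 * (1/4) ^ i) ∂mu := by
      refine integral_mono (integ (by fun_prop)) (integ (by fun_prop)) fun t => ?_
      have ha := ha t
      have hb := hb t
      simp only [ContinuousMap.coe_mk] at ha hb ⊢
      have h8 : ((1:ℝ)/4) ^ i = (1/2) ^ i * (1/2) ^ i := by rw [← mul_pow]; norm_num
      rw [h8]
      have := norm_nonneg (f i t)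
      nlinarith [sq_nonneg (‖f i t‖ - (1/2) ^ i)]
    rw [integral_add (integ (by fun_prop)) (integ (by fun_prop)), integral_const_mul] at h4
    simp at h4
    have := hf i
    simp at this ⊢
    linarith
  choose h hA h2 hh using hex
  have hest : ∀ j : Fin k, ‖I (fourier (-(n j)) * F f h k) - w j‖ ≤ (1/6) * (1/4) ^ (b j) := by
    intro j
    refine coeff_est hA h2 hf hh (n j) (b j) k ?_ (w j) ?_ ?_
    · have : Nat.log 4 ((j:ℕ) + 1) < j + 1 := Nat.log_lt_self _ (by omega)
      have := j.2
      simp only [b]; omega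
    · intro l
      rw [I_trig (s l) w n hn.injective j]
      simp [s, eq_comm]
    · intro l hl g hg
      simp only [f]
      rw [Finset.sum_mul, Finset.mul_sum, map_sum]
      refine Finset.sum_eq_zero fun i hi => ?_
      have hi : b i = l := (Finset.mem_filter.1 hi).2
      have hij : i < j := by
        by_contra hcon
        have : (j:ℕ) + 1 ≤ i + 1 := by have := not_lt.1 hcon; simpa using this
        have := Nat.log_mono_right (b := 4) this
        simp only [b] at hi hl
        omega
      have hlt := hn hij
      rw [smul_mul_assoc, mul_smul_comm, map_smul, ← mul_assoc, fourier_mul]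
      have e : -(n j) + n i = -(n j - n i) := by ring
      rw [e, hardy (by omega) hg, smul_zero]
  set φ : CT := ∑ j : Fin k, a j • fourier (n j) with hφ
  have hup : ‖I (φ * star (F f h k))‖ ≤ C0 * ∫ t, ‖φ t‖ ∂mu := by
    refine (norm_I_le _).trans ?_
    rw [← integral_const_mul]
    refine integral_mono (integ (by fun_prop)) (integ (by fun_prop)) fun t => ?_
    simp only [ContinuousMap.mul_apply, ContinuousMap.star_apply, norm_mul, norm_star]
    rw [mul_comm]
    gcongr
    exact F_bound h1 h2 k t
  have hlow : (1/6) * ∑ j : Fin k, ‖a j‖ / ((j : ℕ) + 1) ≤ (I (φ * star (F f h k))).re := by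
    rw [hφ, I_pair, Complex.re_sum, Finset.mul_sum]
    refine Finset.sum_le_sum fun j _ => ?_
    set c := I (fourier (-(n j)) * F f h k)
    have e1 : a j * conj c = a j * conj (w j) + a j * conj (c - w j) := by
      rw [map_sub]; ring
    have e2 : a j * conj (w j) = ((‖a j‖ * ((1/3) * (1/4) ^ (b j)) : ℝ) : ℂ) := by
      by_cases h0 : a j = 0
      · simp [h0]
      · have hne : (‖a j‖ : ℂ) ≠ 0 := by simpa using h0
        have : a j * conj (a j) = (‖a j‖ : ℂ) ^ 2 := Complex.mul_conj' _
        simp only [w, map_mul, map_div₀, map_pow, Complex.conj_ofReal, map_one, map_ofNat]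
        push_cast
        rw [← mul_assoc, ← mul_div_assoc, this]
        field_simp
    have e3 : |(a j * conj (c - w j)).re| ≤ ‖a j‖ * ((1/6) * (1/4) ^ (b j)) := by
      refine (Complex.abs_re_le_norm _).trans ?_
      rw [norm_mul, RCLike.norm_conj]
      gcongr
      exact hest j
    rw [e1, Complex.add_re, e2, Complex.ofReal_re]
    have e4 : 1 / ((j:ℝ) + 1) ≤ (1/4) ^ (b j) := by
      have : 4 ^ (b j) ≤ (j:ℕ) + 1 := Nat.pow_log_le_self 4 (by omega)
      have h' : (4:ℝ) ^ (b j) ≤ (j:ℕ) + 1 := by exact_mod_cast this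
      rw [one_div_pow]
      exact one_div_le_one_div_of_le (by positivity) h'
    have e5 : ‖a j‖ / ((j:ℕ) + 1) ≤ ‖a j‖ * (1/4) ^ (b j) := by
      rw [div_eq_mul_one_div]; gcongr
    have := (abs_le.1 e3).1
    nlinarith
  have hfin := hlow.trans ((Complex.re_le_norm _).trans hup)
  have hC := C0_pos
  rw [one_div, mul_inv, mul_comm _ C0⁻¹, mul_assoc, inv_mul_le_iff₀ hC]
  simpa using hfin

end LW

theorem littlewood_L1_conjecture :
    ∃ c : ℝ, 0 < c ∧ ∀ (k : ℕ) (a : Fin k → ℂ) (n : Fin k → ℤ), StrictMono n →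
      c * ∑ j : Fin k, ‖a j‖ / ((j : ℕ) + 1) ≤
        ∫ t in (0:ℝ)..1, ‖∑ j : Fin k, a j * Complex.exp (2 * Real.pi * Complex.I * (n j) * t)‖ := by
  refine ⟨1 / (6 * LW.C0), one_div_pos.2 (mul_pos (by norm_num) LW.C0_pos), ?_⟩
  intro k a n hn
  refine (LW.main_circle k a n hn).trans (le_of_eq ?_)
  rw [AddCircle.integral_haarAddCircle, inv_one, one_smul,
    ← AddCircle.intervalIntegral_preimage 1 0, zero_add]
  refine intervalIntegral.integral_congr fun t _ => ?_
  simp only [ContinuousMap.sum_apply, ContinuousMap.smul_apply, smul_eq_mul]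
  congr 1
  refine Finset.sum_congr rfl fun j _ => ?_
  rw [fourier_coe_apply]
  simp
end

section
/- For every finite set $A$ of non-negative integers with $|A| = N$ sufficiently large, the cosine polynomial $f_A(t) = \sum_{n \in A} \cos(nt)$ has at least $(\log\log N)^{1 - o(1)}$ zeros in $[0, 2\pi]$; concretely, for every $\varepsilon > 0$ there exists $N_0$ such that for all $N \geq N_0$ and all $A$ with $|A| = N$, the number of zeros of $f_A$ in $[0, 2\pi]$ is at least $(\log\log N)^{1 - \varepsilon}$. -/
open Real

namespace LZ

/-- the point `e^{it}` -/
noncomputable def ee (t : ℝ) : ℂ := Complex.exp (t * Complex.I)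

lemma ee_cont : Continuous ee := by unfold ee; fun_prop

lemma ee_norm (t : ℝ) : ‖ee t‖ = 1 := by simp [ee, Complex.norm_exp_ofReal_mul_I]

lemma ee_ne (t : ℝ) : ee t ≠ 0 := Complex.exp_ne_zero _

lemma ee_zpow (n : ℤ) (t : ℝ) : ee t ^ n = Complex.exp (n * t * Complex.I) := by
  unfold ee
  rw [← Complex.exp_int_mul]; ring_nf

lemma ee_per (t : ℝ) : ee (t + 2 * π) = ee t := by
  unfold ee
  push_cast
  rw [add_mul, Complex.exp_add, Complex.exp_two_pi_mul_I, mul_one]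

lemma circ_mean (G : ℂ → ℂ) (hG : Differentiable ℂ G) :
    ∫ t in (0 : ℝ)..(2 * π), G (ee t) = 2 * π * G 0 := by
  have h := DiffContOnCl.circleAverage (f := G) (c := 0) (R := 1) (hG.diffContOnCl)
  rw [circleAverage_def] at h
  have e : ∀ t : ℝ, circleMap 0 1 t = ee t := by intro t; simp [circleMap, ee]
  simp only [e] at h
  rw [← h]
  have : (2 * π : ℂ) ≠ 0 := by
    norm_cast; positivity
  rw [Complex.real_smul]
  push_cast
  rw [← mul_assoc, mul_inv_cancel₀ this, one_mul]

lemma circ_zero (G : ℂ → ℂ) (hG : Differentiable ℂ G) (p : ℤ) (hp : 0 < p) :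
    ∫ t in (0 : ℝ)..(2 * π), ee t ^ p * G (ee t) = 0 := by
  obtain ⟨k, rfl⟩ := Int.eq_ofNat_of_zero_le hp.le
  have := circ_mean (fun z => z ^ k * G z) (by fun_prop)
  have hk : k ≠ 0 := by rintro rfl; simp at hp
  simpa [hk] using this

lemma circ_zpow (p : ℤ) : ∫ t in (0 : ℝ)..(2 * π), ee t ^ p = if p = 0 then 2 * (π : ℂ) else 0 := by
  split_ifs with h
  · subst h; simp
  · rcases lt_or_gt_of_ne h with h | h
    · have := circ_zero (fun _ => 1) (by fun_prop) (-p) (by omega)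
      simp only [mul_one] at this
      have h2 : ∀ t, ee t ^ p = (starRingEnd ℂ) (ee t ^ (-p)) := by
        intro t
        rw [zpow_neg, map_inv₀, map_zpow₀, ← zpow_neg, ← inv_zpow', ]
        congr 1
        rw [Complex.inv_def, Complex.normSq_eq_norm_sq]
        simp [ee_norm]
      simp_rw [h2]
      rw [intervalIntegral.intervalIntegral_eq_integral_uIoc] at this ⊢
      simp only [integral_conj]
      rw [smul_eq_zero] at this ⊢
      rcases this with h | h
      · exact Or.inl h
      · right; rw [h]; simp
    · simpa using circ_zero (fun _ => 1) (by fun_prop) p h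

lemma exists_h (φ : ℝ → ℝ) (hφ : Continuous φ) (hper : Function.Periodic φ (2 * π))
    (η : ℝ) (hη : 0 < η) : ∃ h : ℂ → ℂ, Differentiable ℂ h ∧
      (∀ t, φ t ≤ (h (ee t)).re ∧ (h (ee t)).re ≤ φ t + η) ∧
      ∫ t in (0:ℝ)..(2*π), ‖h (ee t)‖ ^ 2 ≤ 2 * ∫ t in (0:ℝ)..(2*π), ((h (ee t)).re) ^ 2 := by
  have : Fact (0 < 2 * π) := ⟨by positivity⟩
  let ψ : C(AddCircle (2 * π), ℂ) := ⟨fun x => ((hper.lift x : ℝ) : ℂ), by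
    refine Complex.continuous_ofReal.comp ?_
    exact continuous_coinduced_dom.mpr hφ⟩
  have hψ : ∀ t : ℝ, ψ (t : AddCircle (2*π)) = φ t := fun t => rfl
  have hmem : ψ ∈ (Submodule.span ℂ (Set.range <| @fourier (2*π))).topologicalClosure := by
    rw [span_fourier_closure_eq_top]; trivial
  have hmem' : ψ ∈ closure ((Submodule.span ℂ (Set.range <| @fourier (2*π))) : Set C(AddCircle (2 * π), ℂ)) := hmem
  rw [Metric.mem_closure_iff] at hmem'
  obtain ⟨p, hp, hd⟩ := hmem' (η/2) (by positivity)
  have key : ∃ h1 h2 : ℂ → ℂ, Differentiable ℂ h1 ∧ Differentiable ℂ h2 ∧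
      ∀ t : ℝ, p (t : AddCircle (2*π)) = h1 (ee t) + (starRingEnd ℂ) (h2 (ee t)) := by
    clear hd
    replace hp : p ∈ Submodule.span ℂ (Set.range <| @fourier (2*π)) := hp
    induction hp using Submodule.span_induction with
    | mem x hx =>
      obtain ⟨n, rfl⟩ := hx
      have e : ∀ t : ℝ, fourier n (t : AddCircle (2*π)) = ee t ^ n := by
        intro t
        rw [fourier_coe_apply, ee_zpow]
        congr 1
        have : (π : ℂ) ≠ 0 := by exact_mod_cast Real.pi_ne_zero
        push_cast
        field_simp
      rcases le_total 0 n with h | h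
      · obtain ⟨k, rfl⟩ := Int.eq_ofNat_of_zero_le h
        refine ⟨fun z => z ^ k, fun _ => 0, by fun_prop, by fun_prop, fun t => ?_⟩
        rw [e]; simp
      · obtain ⟨k, hk⟩ := Int.eq_ofNat_of_zero_le (neg_nonneg.mpr h)
        refine ⟨fun _ => 0, fun z => z ^ k, by fun_prop, by fun_prop, fun t => ?_⟩
        rw [e]
        have hn : n = -(k:ℤ) := by omega
        rw [hn, zpow_neg, zpow_natCast, map_pow, zero_add, ← inv_pow]
        congr 1
        rw [Complex.inv_def, Complex.normSq_eq_norm_sq]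
        simp [ee_norm]
    | zero => exact ⟨fun _ => 0, fun _ => 0, by fun_prop, by fun_prop, fun t => by simp⟩
    | add x y _ _ hx hy =>
      obtain ⟨a, b, ha, hb, h1⟩ := hx
      obtain ⟨c, d, hc, hd, h2⟩ := hy
      refine ⟨fun z => a z + c z, fun z => b z + d z, by fun_prop, by fun_prop, fun t => ?_⟩
      simp only [ContinuousMap.add_apply, h1, h2, map_add]; ring
    | smul c x _ hx =>
      obtain ⟨a, b, ha, hb, h1⟩ := hx
      refine ⟨fun z => c * a z, fun z => (starRingEnd ℂ) c * b z, by fun_prop, by fun_prop, fun t => ?_⟩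
      simp only [ContinuousMap.smul_apply, h1, smul_eq_mul, map_mul, Complex.conj_conj]; ring
  obtain ⟨h1, h2, hd1, hd2, hpe⟩ := key
  let c0 : ℂ := ((h1 0 + h2 0).im : ℂ) * Complex.I
  let h : ℂ → ℂ := fun z => h1 z + h2 z - c0 + (η / 2 : ℝ)
  have hdiff : Differentiable ℂ h := by fun_prop
  have hre : ∀ t, (h (ee t)).re = (p (t : AddCircle (2*π))).re + η / 2 := by
    intro t; rw [hpe]; simp [h, c0]
  have h0 : (h 0).im = 0 := by simp [h, c0]
  have hc : Continuous fun t => h (ee t) := hdiff.continuous.comp ee_cont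
  refine ⟨h, hdiff, fun t => ?_, ?_⟩
  · have h3 : ‖ψ (t : AddCircle (2*π)) - p t‖ < η / 2 := by
      rw [← dist_eq_norm]; exact lt_of_le_of_lt (ContinuousMap.dist_apply_le_dist _) hd
    rw [hψ] at h3
    have h4 := lt_of_le_of_lt (Complex.abs_re_le_norm _) h3
    rw [abs_lt] at h4
    simp at h4
    rw [hre]; constructor <;> linarith [h4.1, h4.2]
  · have hm := circ_mean (fun z => h z ^ 2) (by fun_prop)
    have hm2 := congrArg Complex.re hm
    have e1 : (∫ t in (0:ℝ)..(2*π), h (ee t) ^ 2).re = ∫ t in (0:ℝ)..(2*π), (h (ee t) ^ 2).re := by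
      have := Complex.reCLM.intervalIntegral_comp_comm (μ := MeasureTheory.volume) (a := 0) (b := 2*π) (f := fun t => h (ee t) ^ 2)
        ((hc.pow 2).intervalIntegrable _ _)
      simpa using this.symm
    have e2 : ∀ t, ‖h (ee t)‖ ^ 2 = 2 * (h (ee t)).re ^ 2 - (h (ee t) ^ 2).re := by
      intro t
      rw [Complex.sq_norm, Complex.normSq_apply]
      simp [pow_two]; ring
    simp_rw [e2]
    rw [intervalIntegral.integral_sub, ← e1, hm2, intervalIntegral.integral_const_mul]
    · have : (2 * (π:ℂ) * h 0 ^ 2).re = 2 * π * (h 0).re ^ 2 := by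
        have : h 0 = ((h 0).re : ℂ) := by apply Complex.ext <;> simp [h0]
        rw [this]; norm_cast
      rw [this]
      have := Real.pi_pos
      have : 0 ≤ 2 * π * (h 0).re ^ 2 := by positivity
      linarith
    · apply Continuous.intervalIntegrable
      exact ((Complex.continuous_re.comp hc).pow 2).const_mul 2
    · apply Continuous.intervalIntegrable
      exact Complex.continuous_re.comp (hc.pow 2)

end LZ
open Real

namespace LZ

lemma exp_sub_one_bd (z : ℂ) (hz : 0 ≤ z.re) : ‖Complex.exp (-z) - 1‖ ≤ ‖z‖ := by
  have := Convex.norm_image_sub_le_of_norm_deriv_le (𝕜 := ℂ) (f := Complex.exp) (C := 1)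
    (s := {w : ℂ | w.re ≤ 0}) (x := 0) (y := -z)
    (fun x _ => Complex.differentiable_exp x)
    (fun x hx => by
      rw [Complex.deriv_exp, Complex.norm_exp]
      exact Real.exp_le_one_iff.mpr hx)
    (convex_halfSpace_re_le 0) (by simp) (by simpa using hz)
  simpa using this

lemma conj_ee (t : ℝ) (n : ℤ) : (starRingEnd ℂ) (ee t ^ n) = ee t ^ (-n) := by
  rw [map_zpow₀, ← inv_zpow']
  congr 1
  rw [Complex.inv_def, Complex.normSq_eq_norm_sq]
  simp [ee_norm]

lemma ee_zpow_cont (n : ℤ) : Continuous fun t => ee t ^ n :=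
  ee_cont.zpow₀ n (fun t => Or.inl (ee_ne t))

lemma fblock_sq (S : Finset ℤ) (s : ℤ → ℂ) (hs : ∀ n ∈ S, ‖s n‖ = 1) :
    ∫ t in (0:ℝ)..(2*π), ‖∑ n ∈ S, s n * ee t ^ (-n)‖ ^ 2 = 2 * π * S.card := by
  have h1 : ∀ t : ℝ, ((‖∑ n ∈ S, s n * ee t ^ (-n)‖ ^ 2 : ℝ) : ℂ) =
      ∑ n ∈ S, ∑ m ∈ S, (s n * (starRingEnd ℂ) (s m)) * ee t ^ (m - n) := by
    intro t
    have := Complex.mul_conj' (∑ n ∈ S, s n * ee t ^ (-n))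
    push_cast
    rw [← this, map_sum, Finset.sum_mul_sum]
    refine Finset.sum_congr rfl fun n _ => Finset.sum_congr rfl fun m _ => ?_
    rw [map_mul, conj_ee, neg_neg, sub_eq_add_neg, zpow_add₀ (ee_ne t)]
    ring
  have h2 : ((∫ t in (0:ℝ)..(2*π), ‖∑ n ∈ S, s n * ee t ^ (-n)‖ ^ 2 : ℝ) : ℂ) = 2 * π * S.card := by
    rw [← intervalIntegral.integral_ofReal]
    simp_rw [h1]
    rw [intervalIntegral.integral_finsetSum]
    · have : ∀ n ∈ S, ∫ t in (0:ℝ)..(2*π), ∑ m ∈ S, (s n * (starRingEnd ℂ) (s m)) * ee t ^ (m - n)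
          = 2 * π := by
        intro n hn
        rw [intervalIntegral.integral_finsetSum]
        · simp_rw [intervalIntegral.integral_const_mul, circ_zpow, sub_eq_zero]
          simp [Finset.sum_ite_eq', hn, Complex.mul_conj', hs n hn]
        · intro m _
          exact ((ee_zpow_cont _).const_mul _).intervalIntegrable _ _
      rw [Finset.sum_congr rfl this]
      simp; ring
    · intro n _
      exact (continuous_finsetSum _ fun m _ => ((ee_zpow_cont _).const_mul _)).intervalIntegrable _ _
  exact_mod_cast h2

/-- The bounded test function. -/
lemma F_bound (J : ℕ) (f h : ℕ → ℂ) (hf1 : ∀ i, ‖f i‖ ≤ 1) (hfh : ∀ i, ‖f i‖ ≤ (h i).re) :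
    ‖∑ i ∈ Finset.range J, f i * Complex.exp (-((1/16 : ℂ) * ∑ l ∈ Finset.Ioo i J, h l))‖ ≤ 32 := by
  induction J with
  | zero => simp
  | succ J ih =>
    rw [Finset.sum_range_succ]
    have e1 : Finset.Ioo J (J+1) = ∅ := by ext x; simp
    have e2 : ∑ i ∈ Finset.range J, f i * Complex.exp (-((1/16 : ℂ) * ∑ l ∈ Finset.Ioo i (J+1), h l))
        = (∑ i ∈ Finset.range J, f i * Complex.exp (-((1/16 : ℂ) * ∑ l ∈ Finset.Ioo i J, h l))) *
          Complex.exp (-((1/16 : ℂ) * h J)) := by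
      rw [Finset.sum_mul]
      refine Finset.sum_congr rfl fun i hi => ?_
      have hi' := Finset.mem_range.mp hi
      have : Finset.Ioo i (J+1) = insert J (Finset.Ioo i J) := by ext x; simp; omega
      rw [this, Finset.sum_insert (by simp), mul_assoc, ← Complex.exp_add]
      congr 2; ring
    rw [e2, e1]
    simp only [Finset.sum_empty, mul_zero, neg_zero, Complex.exp_zero, mul_one]
    refine (norm_add_le _ _).trans ?_
    rw [norm_mul, Complex.norm_exp]
    have hre : (-((1/16 : ℂ) * h J)).re = -((h J).re / 16) := by
      have : (1/16 : ℂ) = ((1/16 : ℝ) : ℂ) := by norm_num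
      rw [this, Complex.neg_re, Complex.re_ofReal_mul]; ring
    rw [hre]
    set x := ‖f J‖ with hx
    have hx0 : 0 ≤ x := norm_nonneg _
    have hx1 : x ≤ 1 := hf1 J
    have h3 : Real.exp (-((h J).re / 16)) ≤ Real.exp (-(x/16)) := by
      apply Real.exp_le_exp.mpr; have := hfh J; linarith
    have h4 : Real.exp (-(x/16)) ≤ 1 - x / 32 := by
      have := Real.abs_exp_sub_one_sub_id_le (x := -(x/16)) (by rw [abs_le]; constructor <;> linarith)
      have := (abs_le.mp this).2
      nlinarith
    have : ‖∑ i ∈ Finset.range J, f i * Complex.exp (-((1/16 : ℂ) * ∑ l ∈ Finset.Ioo i J, h l))‖ *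
        Real.exp (-((h J).re / 16)) ≤ 32 * (1 - x/32) :=
      mul_le_mul ih (h3.trans h4) (Real.exp_pos _).le (by norm_num)
    linarith

lemma sum_two_pow (i J : ℕ) : ∑ l ∈ Finset.Ioo i J, ((1:ℝ)/2) ^ l ≤ (1/2)^i := by
  induction J with
  | zero => simp
  | succ J ih =>
    rcases lt_or_ge i J with h | h
    · have key : ∀ J, i < J → ∑ l ∈ Finset.Ioo i J, ((1:ℝ)/2) ^ l = (1/2)^i - 2 * (1/2)^J := by
        intro J hJ
        induction J, hJ using Nat.le_induction with
        | base =>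
          have : Finset.Ioo i (i+1) = ∅ := by ext x; simp
          rw [show i.succ = i + 1 from rfl, this]; simp; ring
        | succ J hJ ih =>
          have : Finset.Ioo i (J+1) = insert J (Finset.Ioo i J) := by ext x; simp; omega
          rw [this, Finset.sum_insert (by simp), ih]; ring
      rw [key (J+1) (by omega)]
      have : (0:ℝ) ≤ 2 * (1/2)^(J+1) := by positivity
      linarith
    · have : Finset.Ioo i (J+1) = ∅ := by ext x; simp; omega
      rw [this]; simp

lemma sum_four_pow (j J : ℕ) : ∑ l ∈ Finset.Ico j J, ((1:ℝ)/4) ^ l ≤ 4/3 * (1/4)^j := by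
  rcases lt_or_ge j J with h | h
  · have key : ∀ J, j < J → ∑ l ∈ Finset.Ico j J, ((1:ℝ)/4) ^ l = 4/3*(1/4)^j - 4/3 * (1/4)^J := by
      intro J hJ
      induction J, hJ using Nat.le_induction with
      | base => simp; ring
      | succ J hJ ih =>
        rw [Finset.sum_Ico_succ_top (by omega), ih]; ring
    rw [key J h]
    have : (0:ℝ) ≤ 4/3 * (1/4)^J := by positivity
    linarith
  · rw [Finset.Ico_eq_empty (by omega)]; simp

lemma cross (f h : ℝ → ℂ) (hf : Continuous f) (hh : Continuous h) (i l : ℕ)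
    (h1 : ∫ t in (0:ℝ)..(2*π), ‖f t‖ ^ 2 ≤ 2 * π * ((1/4)^i / 3))
    (h2 : ∫ t in (0:ℝ)..(2*π), ‖h t‖ ^ 2 ≤ 2 * π * (8/3 * (1/4)^l)) :
    ∫ t in (0:ℝ)..(2*π), ‖f t‖ * ‖h t‖ ≤ 2 * π * (3/2 * (1/2)^i * (1/2)^l) := by
  have hp : (0:ℝ) ≤ 2 * π := by positivity
  set μ : ℝ := (1/2)^l * 2^i with hμ
  set ν : ℝ := (1/2)^i * 2^l with hν
  have hi : ((1:ℝ)/2)^i * 2^i = 1 := by rw [← mul_pow]; norm_num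
  have hl : ((1:ℝ)/2)^l * 2^l = 1 := by rw [← mul_pow]; norm_num
  have hμν : μ * ν = 1 := by
    rw [hμ, hν]
    calc _ = (((1:ℝ)/2)^i * 2^i) * ((1/2)^l * 2^l) := by ring
      _ = 1 := by rw [hi, hl]; norm_num
  have hμ0 : 0 < μ := by positivity
  have hν0 : 0 < ν := by positivity
  have hle : ∀ t ∈ Set.Icc (0:ℝ) (2*π), ‖f t‖ * ‖h t‖ ≤ μ / 2 * ‖f t‖^2 + ν/2 * ‖h t‖^2 := by
    intro t _
    have : 0 ≤ μ * (‖f t‖ - ν * ‖h t‖)^2 := by positivity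
    have e : μ * (‖f t‖ - ν * ‖h t‖)^2 = μ * ‖f t‖^2 - 2 * (μ*ν) * (‖f t‖ * ‖h t‖) + (μ*ν) * ν * ‖h t‖^2 := by ring
    rw [e, hμν] at this
    linarith
  have hfc : Continuous fun t => ‖f t‖ := hf.norm
  have hhc : Continuous fun t => ‖h t‖ := hh.norm
  have c0 : Continuous fun t => ‖f t‖ * ‖h t‖ := by fun_prop
  have c1 : Continuous fun t => μ/2 * ‖f t‖^2 := by fun_prop
  have c2 : Continuous fun t => ν/2 * ‖h t‖^2 := by fun_prop
  have c3 : Continuous fun t => μ/2 * ‖f t‖^2 + ν/2 * ‖h t‖^2 := by fun_prop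
  have := intervalIntegral.integral_mono_on (μ := MeasureTheory.volume) hp (c0.intervalIntegrable _ _)
    (c3.intervalIntegrable _ _) hle
  refine this.trans ?_
  rw [intervalIntegral.integral_add (c1.intervalIntegrable _ _)
    (c2.intervalIntegrable _ _), intervalIntegral.integral_const_mul,
    intervalIntegral.integral_const_mul]
  have a1 := mul_le_mul_of_nonneg_left h1 (by positivity : 0 ≤ μ/2)
  have a2 := mul_le_mul_of_nonneg_left h2 (by positivity : 0 ≤ ν/2)
  have q : ∀ k : ℕ, ((1:ℝ)/4)^k = (1/2)^k * (1/2)^k := by intro k; rw [← mul_pow]; norm_num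
  have b1 : μ/2 * (2 * π * ((1/4)^i / 3)) = 2 * π * (1/6 * (1/2)^i * (1/2)^l) := by
    rw [q, hμ]
    linear_combination (2 * π * (1/6 * (1/2)^i * (1/2)^l)) * hi
  have b2 : ν/2 * (2 * π * (8/3 * (1/4)^l)) = 2 * π * (4/3 * (1/2)^i * (1/2)^l) := by
    rw [q, hν]
    linear_combination (2 * π * (4/3 * (1/2)^i * (1/2)^l)) * hl
  rw [b1] at a1; rw [b2] at a2
  linarith

end LZ
open Real

namespace LZ

lemma mps_core (J : ℕ) (S : ℕ → Finset ℤ) (hcard : ∀ j < J, (S j).card = 3 * 4 ^ j)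
    (hord : ∀ i j, i < j → j < J → ∀ x ∈ S i, ∀ y ∈ S j, x < y)
    (R : Finset ℤ) (hsub : ∀ j < J, S j ⊆ R)
    (hR : ∀ n ∈ R, (∃ j < J, n ∈ S j) ∨ (∀ j < J, ∀ x ∈ S j, x < n))
    (c : ℤ → ℂ) (hc : ∀ n ∈ R, 1 ≤ ‖c n‖) :
    π * J ≤ 32 * ∫ t in (0:ℝ)..(2*π), ‖∑ n ∈ R, c n * ee t ^ n‖ := by
  have hπ := Real.pi_pos
  have h2π : (0:ℝ) ≤ 2 * π := by positivity
  let s : ℤ → ℂ := fun n => if c n = 0 then 1 else (starRingEnd ℂ) (c n) / ‖c n‖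
  have hs : ∀ n, ‖s n‖ = 1 := by
    intro n; simp only [s]; split_ifs with h
    · simp
    · have : ‖c n‖ ≠ 0 := by simpa using h
      rw [norm_div, RCLike.norm_conj, Complex.norm_real, norm_norm, div_self this]
  have hcs : ∀ n, c n * s n = ‖c n‖ := by
    intro n; simp only [s]; split_ifs with h
    · simp [h]
    · have : (‖c n‖ : ℂ) ≠ 0 := by simpa using h
      rw [← mul_div_assoc, Complex.mul_conj', pow_two, mul_div_assoc, div_self this, mul_one]
  let f : ℕ → ℝ → ℂ := fun j t => if j < J then ((3 * 4 ^ j : ℝ) : ℂ)⁻¹ * ∑ n ∈ S j, s n * ee t ^ (-n) else 0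
  have hfc : ∀ j, Continuous (f j) := by
    intro j; simp only [f]; split_ifs
    · exact (continuous_finsetSum _ fun n _ => (ee_zpow_cont _).const_mul _).const_mul _
    · exact continuous_const
  have hfper : ∀ j, Function.Periodic (fun t => ‖f j t‖) (2 * π) := by
    intro j t; simp only [f, ee_per]
  have hf1 : ∀ j t, ‖f j t‖ ≤ 1 := by
    intro j t; simp only [f]; split_ifs with hj
    · have h1 : ‖∑ n ∈ S j, s n * ee t ^ (-n)‖ ≤ 3 * 4 ^ j := by
        refine (norm_sum_le _ _).trans ?_
        simp [hs, ee_norm, hcard j hj]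
      rw [norm_mul, norm_inv, Complex.norm_real, Real.norm_of_nonneg (by positivity)]
      rw [inv_mul_le_iff₀ (by positivity)]; linarith
    · simp
  have hfsq : ∀ j, ∫ t in (0:ℝ)..(2*π), ‖f j t‖ ^ 2 ≤ 2 * π * ((1/4)^j / 3) := by
    intro j; simp only [f]; split_ifs with hj
    · simp_rw [norm_mul, mul_pow]
      rw [intervalIntegral.integral_const_mul, fblock_sq _ _ (fun n _ => hs n), hcard j hj, norm_inv,
        Complex.norm_real, Real.norm_of_nonneg (by positivity)]
      push_cast
      rw [one_div, inv_pow]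
      apply le_of_eq
      have q : (4:ℝ)^j * (1/4)^j = 1 := by rw [← mul_pow]; norm_num
      have q4 : (4:ℝ)^j ≠ 0 := by positivity
      field_simp
      exact q.symm
    · simp; positivity
  have hex := fun j => exists_h (fun t => ‖f j t‖) (hfc j).norm (hfper j) ((1/2)^j/2) (by positivity)
  choose h hhd hhb hhs using hex
  have hhc : ∀ j, Continuous fun t => h j (ee t) := fun j => (hhd j).continuous.comp ee_cont
  have hhsq : ∀ j, ∫ t in (0:ℝ)..(2*π), ‖h j (ee t)‖ ^ 2 ≤ 2 * π * (8/3 * (1/4)^j) := by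
    intro j
    refine (hhs j).trans ?_
    have h1 : ∫ t in (0:ℝ)..(2*π), ((h j (ee t)).re) ^ 2 ≤
        ∫ t in (0:ℝ)..(2*π), (2 * ‖f j t‖^2 + (1/4)^j/2) := by
      apply intervalIntegral.integral_mono_on h2π
      · exact ((Complex.continuous_re.comp (hhc j)).pow 2).intervalIntegrable _ _
      · exact ((((hfc j).norm.pow 2).const_mul 2).add continuous_const).intervalIntegrable _ _
      · intro t _
        obtain ⟨a, b⟩ := hhb j t
        have n0 := norm_nonneg (f j t)
        have e : ((1:ℝ)/4)^j = (1/2)^j * (1/2)^j := by rw [← mul_pow]; norm_num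
        rw [e]
        set y := ((1:ℝ)/2)^j
        nlinarith [sq_nonneg (‖f j t‖ - y/2)]
    have d1 : Continuous fun t => 2 * ‖f j t‖^2 := by have := hfc j; fun_prop
    rw [intervalIntegral.integral_add (d1.intervalIntegrable _ _)
      (continuous_const.intervalIntegrable _ _), intervalIntegral.integral_const_mul,
      intervalIntegral.integral_const] at h1
    have := hfsq j
    simp only [sub_zero, smul_eq_mul] at h1
    have y0 : 0 ≤ π * ((1:ℝ)/4)^j := by positivity
    nlinarith
  have hre0 : ∀ j t, 0 ≤ (h j (ee t)).re := fun j t => (norm_nonneg _).trans (hhb j t).1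
  let E : ℕ → ℂ → ℂ := fun i z => Complex.exp (-((1/16 : ℂ) * ∑ l ∈ Finset.Ioo i J, h l z))
  have hEd : ∀ i, Differentiable ℂ (E i) := by
    intro i; simp only [E]
    have : Differentiable ℂ fun z => ∑ l ∈ Finset.Ioo i J, h l z := by
      apply Differentiable.fun_sum; intro l _; exact hhd l
    fun_prop
  have hEc : ∀ i, Continuous fun t => E i (ee t) := fun i => (hEd i).continuous.comp ee_cont
  let I : ℕ → ℤ → ℂ := fun i n => ∫ t in (0:ℝ)..(2*π), ee t ^ n * (f i t * E i (ee t))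
  -- (a)
  have hIa : ∀ i n, (∀ x ∈ S i, x < n) → I i n = 0 := by
    intro i n hx
    simp only [I, f]
    split_ifs with hi
    · have e : ∀ t, ee t ^ n * (((3 * 4 ^ i : ℝ) : ℂ)⁻¹ * (∑ n ∈ S i, s n * ee t ^ (-n)) * E i (ee t))
          = ∑ m ∈ S i, (((3 * 4 ^ i : ℝ) : ℂ)⁻¹ * s m) * (ee t ^ (n - m) * E i (ee t)) := by
        intro t
        rw [Finset.mul_sum, Finset.sum_mul, Finset.mul_sum]
        refine Finset.sum_congr rfl fun m _ => ?_
        rw [sub_eq_add_neg, zpow_add₀ (ee_ne t)]; ring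
      simp_rw [e]
      rw [intervalIntegral.integral_finsetSum]
      · apply Finset.sum_eq_zero
        intro m hm
        rw [intervalIntegral.integral_const_mul, circ_zero _ (hEd i) _ (by have := hx m hm; omega), mul_zero]
      · intro m _
        exact (((ee_zpow_cont _).mul (hEc i)).const_mul _).intervalIntegrable _ _
    · simp
  -- (c)
  have hIc : ∀ i < J, ∀ n, ∫ t in (0:ℝ)..(2*π), ee t ^ n * f i t =
      if n ∈ S i then ((3 * 4 ^ i : ℝ) : ℂ)⁻¹ * s n * (2 * π) else 0 := by
    intro i hi n
    have e : ∀ t, ee t ^ n * f i t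
          = ∑ m ∈ S i, (((3 * 4 ^ i : ℝ) : ℂ)⁻¹ * s m) * (ee t ^ (n - m)) := by
      intro t
      simp only [f, if_pos hi]
      rw [Finset.mul_sum, Finset.mul_sum]
      refine Finset.sum_congr rfl fun m _ => ?_
      rw [sub_eq_add_neg, zpow_add₀ (ee_ne t)]; ring
    simp_rw [e]
    rw [intervalIntegral.integral_finsetSum]
    · simp_rw [intervalIntegral.integral_const_mul, circ_zpow, sub_eq_zero]
      simp [Finset.sum_ite_eq]
    · intro m _
      exact ((ee_zpow_cont _).const_mul _).intervalIntegrable _ _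
  -- (b)
  have hIb : ∀ i n, ‖I i n - ∫ t in (0:ℝ)..(2*π), ee t ^ n * f i t‖ ≤ 2 * π * (3/32 * (1/4)^i) := by
    intro i n
    simp only [I]
    have d1 : Continuous fun t => ee t ^ n * (f i t * E i (ee t)) := (ee_zpow_cont n).mul ((hfc i).mul (hEc i))
    have d2 : Continuous fun t => ee t ^ n * f i t := (ee_zpow_cont n).mul (hfc i)
    rw [← intervalIntegral.integral_sub (d1.intervalIntegrable _ _) (d2.intervalIntegrable _ _)]
    have c1 : ∀ l, Continuous fun t => ‖f i t‖ * ‖h l (ee t)‖ := fun l => (hfc i).norm.mul (hhc l).norm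
    have c2 : Continuous fun t => (1/16) * ∑ l ∈ Finset.Ioo i J, ‖f i t‖ * ‖h l (ee t)‖ :=
      (continuous_finsetSum _ fun l _ => c1 l).const_mul _
    have b1 : ‖∫ t in (0:ℝ)..(2*π), (ee t ^ n * (f i t * E i (ee t)) - ee t ^ n * f i t)‖ ≤
        ∫ t in (0:ℝ)..(2*π), (1/16) * ∑ l ∈ Finset.Ioo i J, ‖f i t‖ * ‖h l (ee t)‖ := by
      apply intervalIntegral.norm_integral_le_of_norm_le h2π _ (c2.intervalIntegrable _ _)
      filter_upwards with t _
      have e : ee t ^ n * (f i t * E i (ee t)) - ee t ^ n * f i t = ee t ^ n * (f i t * (E i (ee t) - 1)) := by ring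
      rw [e, norm_mul, norm_mul, norm_zpow, ee_norm, one_zpow, one_mul, ← Finset.mul_sum, mul_left_comm]
      apply mul_le_mul_of_nonneg_left _ (norm_nonneg _)
      have h16 : (1/16 : ℂ) = ((1/16 : ℝ) : ℂ) := by norm_num
      refine (exp_sub_one_bd _ ?_).trans ?_
      · rw [h16, Complex.re_ofReal_mul, Complex.re_sum]
        exact mul_nonneg (by norm_num) (Finset.sum_nonneg fun l _ => hre0 l t)
      · rw [norm_mul, h16, Complex.norm_real, Real.norm_of_nonneg (by norm_num)]
        exact mul_le_mul_of_nonneg_left (norm_sum_le _ _) (by norm_num)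
    refine b1.trans ?_
    rw [intervalIntegral.integral_const_mul, intervalIntegral.integral_finsetSum
      (fun l _ => (c1 l).intervalIntegrable _ _)]
    have b2 : ∑ l ∈ Finset.Ioo i J, ∫ t in (0:ℝ)..(2*π), ‖f i t‖ * ‖h l (ee t)‖ ≤
        ∑ l ∈ Finset.Ioo i J, 2 * π * (3/2 * (1/2)^i * (1/2)^l) :=
      Finset.sum_le_sum fun l _ => cross _ _ (hfc i) (hhc l) i l (hfsq i) (hhsq l)
    have b3 : ∑ l ∈ Finset.Ioo i J, 2 * π * (3/2 * (1/2)^i * (1/2)^l)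
        = (2 * π * (3/2 * (1/2)^i)) * ∑ l ∈ Finset.Ioo i J, ((1:ℝ)/2)^l := by
      rw [Finset.mul_sum]; refine Finset.sum_congr rfl fun l _ => by ring
    have b4 := mul_le_mul_of_nonneg_left (sum_two_pow i J) (by positivity : 0 ≤ 2 * π * (3/2 * ((1:ℝ)/2)^i))
    have q : ((1:ℝ)/4)^i = (1/2)^i * (1/2)^i := by rw [← mul_pow]; norm_num
    rw [q]
    nlinarith
  -- combine
  let G : ℝ → ℂ := fun t => ∑ n ∈ R, c n * ee t ^ n
  let F : ℝ → ℂ := fun t => ∑ i ∈ Finset.range J, f i t * E i (ee t)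
  have hFb : ∀ t, ‖F t‖ ≤ 32 := fun t =>
    F_bound J (fun i => f i t) (fun l => h l (ee t)) (fun i => hf1 i t) (fun i => (hhb i t).1)
  have hFc : Continuous F := continuous_finsetSum _ fun i _ => (hfc i).mul (hEc i)
  have hGc : Continuous G := continuous_finsetSum _ fun n _ => (ee_zpow_cont n).const_mul _
  have hup : ‖∫ t in (0:ℝ)..(2*π), G t * F t‖ ≤ 32 * ∫ t in (0:ℝ)..(2*π), ‖G t‖ := by
    rw [← intervalIntegral.integral_const_mul]
    apply intervalIntegral.norm_integral_le_of_norm_le h2π _ ((hGc.norm.const_mul 32).intervalIntegrable _ _)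
    filter_upwards with t _
    rw [norm_mul, mul_comm]
    exact mul_le_mul_of_nonneg_right (hFb t) (norm_nonneg _)
  have hexp : ∫ t in (0:ℝ)..(2*π), G t * F t = ∑ n ∈ R, c n * ∑ i ∈ Finset.range J, I i n := by
    have e : ∀ t, G t * F t = ∑ n ∈ R, ∑ i ∈ Finset.range J, c n * (ee t ^ n * (f i t * E i (ee t))) := by
      intro t
      simp only [G, F]
      rw [Finset.sum_mul_sum]
      refine Finset.sum_congr rfl fun n _ => Finset.sum_congr rfl fun i _ => by ring
    simp_rw [e]
    have cc : ∀ n i, Continuous fun t => c n * (ee t ^ n * (f i t * E i (ee t))) := fun n i =>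
      ((ee_zpow_cont n).mul ((hfc i).mul (hEc i))).const_mul _
    rw [intervalIntegral.integral_finsetSum fun n _ =>
      (continuous_finsetSum _ fun i _ => cc n i).intervalIntegrable _ _]
    refine Finset.sum_congr rfl fun n _ => ?_
    rw [intervalIntegral.integral_finsetSum fun i _ => (cc n i).intervalIntegrable _ _, Finset.mul_sum]
    refine Finset.sum_congr rfl fun i _ => ?_
    rw [intervalIntegral.integral_const_mul]
  have hmain : ∀ j < J, ∀ n ∈ S j, 2 * π * ((1/4)^j * (5/24)) ≤ (c n * ∑ i ∈ Finset.range J, I i n).re := by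
    intro j hj n hn
    have t1 : ∑ i ∈ Finset.range J, I i n = ∑ i ∈ Finset.Ico j J, I i n := by
      symm
      apply Finset.sum_subset
      · intro x hx; simp at hx ⊢; omega
      · intro i hi hni
        have : i < j := by simp at hi hni; omega
        exact hIa i n fun x hx => hord i j this hj x hx n hn
    have t2 : ∑ i ∈ Finset.Ico j J, ∫ t in (0:ℝ)..(2*π), ee t ^ n * f i t
        = ((3 * 4 ^ j : ℝ) : ℂ)⁻¹ * s n * (2 * π) := by
      rw [Finset.sum_eq_single j]
      · rw [hIc j hj, if_pos hn]
      · intro i hi hij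
        simp at hi
        rw [hIc i hi.2, if_neg]
        intro hni
        exact absurd (hord j i (by omega) hi.2 n hn n hni) (lt_irrefl _)
      · intro hh; simp at hh; omega
    have t3 : ‖∑ i ∈ Finset.range J, I i n - ((3 * 4 ^ j : ℝ) : ℂ)⁻¹ * s n * (2 * π)‖ ≤ 2 * π * (1/8 * (1/4)^j) := by
      rw [t1, ← t2, ← Finset.sum_sub_distrib]
      refine (norm_sum_le _ _).trans ((Finset.sum_le_sum fun i _ => hIb i n).trans ?_)
      have := sum_four_pow j J
      have e : ∑ i ∈ Finset.Ico j J, 2 * π * (3/32 * ((1:ℝ)/4)^i) = (2 * π * (3/32)) * ∑ i ∈ Finset.Ico j J, ((1:ℝ)/4)^i := by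
        rw [Finset.mul_sum]; refine Finset.sum_congr rfl fun l _ => by ring
      rw [e]
      have := mul_le_mul_of_nonneg_left this (by positivity : 0 ≤ 2 * π * (3/32))
      nlinarith
    set Y := ∑ i ∈ Finset.range J, I i n with hY
    set e0 := Y - ((3 * 4 ^ j : ℝ) : ℂ)⁻¹ * s n * (2 * π) with he0
    have e1 : c n * Y = ((‖c n‖ * ((3 * 4^j)⁻¹ * (2 * π)) : ℝ) : ℂ) + c n * e0 := by
      have := hcs n
      rw [he0]; push_cast; linear_combination ((3 * 4 ^ j : ℂ)⁻¹ * (2 * π)) * this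
    rw [e1, Complex.add_re, Complex.ofReal_re]
    have e2 : -(‖c n‖ * (2 * π * (1/8 * (1/4)^j))) ≤ (c n * e0).re := by
      have := (abs_le.mp (Complex.abs_re_le_norm (c n * e0))).1
      rw [norm_mul] at this
      have := mul_le_mul_of_nonneg_left t3 (norm_nonneg (c n))
      linarith
    have e3 : ((3 * 4^j)⁻¹ : ℝ) = (1/4)^j / 3 := by rw [one_div, inv_pow]; field_simp
    rw [e3]
    have hc1 := hc n (hsub j hj hn)
    have y0 : 0 ≤ π * ((1:ℝ)/4)^j := by positivity
    nlinarith
  have hlow : π * J ≤ (∑ n ∈ R, c n * ∑ i ∈ Finset.range J, I i n).re := by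
    rw [Complex.re_sum]
    let U := (Finset.range J).biUnion S
    have hU : U ⊆ R := by
      intro x hx; simp [U] at hx; obtain ⟨j, hj, hx⟩ := hx; exact hsub j hj hx
    rw [← Finset.sum_subset hU]
    · rw [Finset.sum_biUnion]
      · have : ∀ j ∈ Finset.range J, π ≤ ∑ n ∈ S j, (c n * ∑ i ∈ Finset.range J, I i n).re := by
          intro j hj
          have hj := Finset.mem_range.mp hj
          have := Finset.card_nsmul_le_sum (S j) _ _ (hmain j hj)
          refine le_trans ?_ this
          rw [hcard j hj, nsmul_eq_mul]
          push_cast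
          have q : (4:ℝ)^j * (1/4)^j = 1 := by rw [← mul_pow]; norm_num
          have : (3 * 4^j : ℝ) * (2 * π * ((1/4)^j * (5/24))) = (5/4) * π * (4^j * (1/4)^j) := by ring
          rw [this, q]; linarith
        have := Finset.card_nsmul_le_sum (Finset.range J) _ _ this
        simpa [mul_comm] using this
      · intro i hi j hj hij
        simp at hi hj
        rw [Function.onFun, Finset.disjoint_left]
        intro x hx hx'
        rcases lt_or_gt_of_ne hij with h' | h'
        · exact lt_irrefl _ (hord i j h' hj x hx x hx')
        · exact lt_irrefl _ (hord j i h' hi x hx' x hx)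
    · intro n hn hnU
      rcases hR n hn with ⟨j, hj, hnj⟩ | hn2
      · exact absurd (by simp [U]; exact ⟨j, hj, hnj⟩) hnU
      · rw [Finset.sum_eq_zero (fun i hi => hIa i n (hn2 i (Finset.mem_range.mp hi)))]; simp
  rw [← hexp] at hlow
  exact hlow.trans ((Complex.re_le_norm _).trans hup)

/-- Littlewood conjecture (McGehee–Pigno–Smith) form. -/
lemma mps (J : ℕ) (R : Finset ℤ) (hcard : 4 ^ J ≤ R.card) (c : ℤ → ℂ) (hc : ∀ n ∈ R, 1 ≤ ‖c n‖) :
    π * J ≤ 32 * ∫ t in (0:ℝ)..(2*π), ‖∑ n ∈ R, c n * ee t ^ n‖ := by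
  classical
  let r : ℤ → ℕ := fun n => (R.filter (· < n)).card + 1
  have hr : ∀ x ∈ R, ∀ y, x < y → r x < r y := by
    intro x hx y hxy
    simp only [r, add_lt_add_iff_right]
    apply Finset.card_lt_card
    rw [Finset.ssubset_iff_of_subset]
    · exact ⟨x, by simp [hx, hxy], by simp⟩
    · intro z hz; simp at hz ⊢; exact ⟨hz.1, hz.2.trans hxy⟩
  have hr' : ∀ x ∈ R, ∀ y ∈ R, r x < r y → x < y := by
    intro x hx y hy h
    by_contra hh
    rcases (not_lt.mp hh).lt_or_eq with h1 | h1
    · have := hr y hy x h1; omega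
    · subst h1; omega
  have hinj : Set.InjOn r R := by
    intro x hx y hy h
    rcases lt_trichotomy x y with h1 | h1 | h1
    · have := hr x hx y h1; omega
    · exact h1
    · have := hr y hy x h1; omega
  have himg : R.image r = Finset.Icc 1 R.card := by
    apply Finset.eq_of_subset_of_card_le
    · intro k hk
      obtain ⟨x, hx, rfl⟩ := Finset.mem_image.mp hk
      simp only [Finset.mem_Icc, r]
      refine ⟨by omega, ?_⟩
      have : (R.filter (· < x)).card < R.card := by
        apply Finset.card_lt_card
        rw [Finset.ssubset_iff_of_subset (Finset.filter_subset _ _)]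
        exact ⟨x, hx, by simp⟩
      omega
    · rw [Finset.card_image_of_injOn hinj]; simp
  let S : ℕ → Finset ℤ := fun j => R.filter (fun n => 4 ^ j ≤ r n ∧ r n < 4 ^ (j+1))
  apply mps_core J S
  · intro j hj
    have h1 : (S j).image r = Finset.Ico (4^j) (4^(j+1)) := by
      ext k
      simp only [Finset.mem_image, Finset.mem_Ico, S, Finset.mem_filter]
      constructor
      · rintro ⟨x, ⟨_, h⟩, rfl⟩; exact h
      · intro h
        have : k ∈ R.image r := by
          rw [himg, Finset.mem_Icc]
          have : 4^(j+1) ≤ 4^J := Nat.pow_le_pow_right (by norm_num) hj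
          have : 1 ≤ 4^j := Nat.one_le_pow _ _ (by norm_num)
          omega
        obtain ⟨x, hx, rfl⟩ := Finset.mem_image.mp this
        exact ⟨x, ⟨hx, h⟩, rfl⟩
    have h2 : ((S j).image r).card = (S j).card :=
      Finset.card_image_of_injOn (hinj.mono (by intro x hx; simp [S] at hx; exact hx.1))
    rw [← h2, h1, Nat.card_Ico, pow_succ]; omega
  · intro i j hij hj x hx y hy
    simp only [S, Finset.mem_filter] at hx hy
    apply hr' x hx.1 y hy.1
    have : 4^(i+1) ≤ 4^j := Nat.pow_le_pow_right (by norm_num) hij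
    omega
  · intro j _; exact Finset.filter_subset _ _
  · intro n hn
    by_cases h : r n < 4 ^ J
    · left
      refine ⟨Nat.log 4 (r n), ?_, ?_⟩
      · apply Nat.log_lt_of_lt_pow (by simp [r]) h
      · simp only [S, Finset.mem_filter]
        exact ⟨hn, Nat.pow_log_le_self 4 (by simp [r]), Nat.lt_pow_succ_log_self (by norm_num) _⟩
    · right
      intro j hj x hx
      simp only [S, Finset.mem_filter] at hx
      apply hr' x hx.1 n hn
      have : 4^(j+1) ≤ 4^J := Nat.pow_le_pow_right (by norm_num) hj
      omega
  · exact hc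

end LZ
open Real

namespace LZ

noncomputable def fA (A : Finset ℕ) (t : ℝ) : ℝ := ∑ n ∈ A, Real.cos (n * t)

noncomputable def FA (A : Finset ℕ) (t : ℝ) : ℝ := ∑ n ∈ A, if n = 0 then t else Real.sin (n * t) / n

lemma fA_cont (A : Finset ℕ) : Continuous (fA A) := by unfold fA; fun_prop

lemma FA_deriv (A : Finset ℕ) (t : ℝ) : HasDerivAt (FA A) (fA A t) t := by
  unfold FA fA
  apply HasDerivAt.fun_sum
  intro n _
  split_ifs with h
  · subst h; simpa using hasDerivAt_id' t
  · have hn : (n:ℝ) ≠ 0 := by exact_mod_cast h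
    have h1 : HasDerivAt (fun t : ℝ => (n:ℝ) * t) n t := by
      simpa using (hasDerivAt_id t).const_mul (n:ℝ)
    have := (h1.sin).div_const (n:ℝ)
    rw [mul_div_cancel_right₀ _ hn] at this
    exact this

lemma sum_inv_le (A : Finset ℕ) : (0 ∉ A) → ∑ n ∈ A, (1:ℝ) / n ≤ ∑ i ∈ Finset.range A.card, 1 / ((i:ℝ) + 1) := by
  induction A using Finset.induction_on_max with
  | empty => simp
  | insert a s ha ih =>
    intro h0
    have hns : a ∉ s := fun h => lt_irrefl _ (ha a h)
    have h0s : 0 ∉ s := fun h => h0 (Finset.mem_insert_of_mem h)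
    have ha0 : a ≠ 0 := fun h => h0 (by simp [h])
    rw [Finset.sum_insert hns, Finset.card_insert_of_notMem hns, Finset.sum_range_succ]
    have hcard : s.card + 1 ≤ a := by
      have : s ⊆ Finset.Ico 1 a := by
        intro x hx
        have : x ≠ 0 := fun h => h0s (h ▸ hx)
        simp; exact ⟨by omega, ha x hx⟩
      have := Finset.card_le_card this
      simp at this; omega
    have : (1:ℝ) / a ≤ 1 / ((s.card : ℝ) + 1) := by
      apply one_div_le_one_div_of_le (by positivity)
      exact_mod_cast hcard
    linarith [ih h0s]

lemma sum_inv_log (A : Finset ℕ) (h0 : 0 ∉ A) : ∑ n ∈ A, (1:ℝ) / n ≤ 1 + Real.log A.card := by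
  refine (sum_inv_le A h0).trans ?_
  have := harmonic_le_one_add_log A.card
  refine le_trans (le_of_eq ?_) this
  rw [harmonic]
  push_cast
  simp

lemma FA_bound (A : Finset ℕ) (t : ℝ) : |FA A t| ≤ |t| + 1 + Real.log A.card := by
  have h1 : FA A t = (∑ n ∈ A.erase 0, Real.sin (n * t) / n) + if 0 ∈ A then t else 0 := by
    unfold FA
    have e : ∑ n ∈ A.erase 0, Real.sin (n * t) / n = ∑ n ∈ A.erase 0, if n = 0 then t else Real.sin (n * t) / n := by
      refine Finset.sum_congr rfl fun n hn => ?_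
      rw [if_neg (Finset.ne_of_mem_erase hn)]
    rw [e]
    split_ifs with h
    · rw [← Finset.sum_erase_add A _ h]; simp
    · rw [Finset.erase_eq_of_notMem h, add_zero]
  have h2 : |∑ n ∈ A.erase 0, Real.sin (n * t) / n| ≤ ∑ n ∈ A.erase 0, (1:ℝ)/n := by
    refine (Finset.abs_sum_le_sum_abs _ _).trans (Finset.sum_le_sum fun n _ => ?_)
    rw [abs_div, Nat.abs_cast]
    apply div_le_div_of_nonneg_right (Real.abs_sin_le_one _) (by positivity)
  have h3 := sum_inv_log (A.erase 0) (by simp)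
  have h4 : Real.log (A.erase 0).card ≤ Real.log A.card := by
    rcases Nat.eq_zero_or_pos (A.erase 0).card with h | h
    · rw [h]; simp; exact Real.log_natCast_nonneg _
    · exact Real.log_le_log (by exact_mod_cast h) (by exact_mod_cast Finset.card_le_card (Finset.erase_subset _ _))
  rw [h1]
  refine (abs_add_le _ _).trans ?_
  have h5 : |if 0 ∈ A then t else 0| ≤ |t| := by split_ifs <;> simp
  linarith

lemma const_sign (f : ℝ → ℝ) (hf : Continuous f) (a b : ℝ) (hab : a < b)
    (hz : ∀ x ∈ Set.Ioo a b, f x ≠ 0) :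
    ∃ e : ℝ, (e = 1 ∨ e = -1) ∧ ∀ x ∈ Set.Icc a b, |f x| = e * f x := by
  have ext : ∀ g : ℝ → ℝ, Continuous g → (∀ x ∈ Set.Ioo a b, 0 ≤ g x) → ∀ x ∈ Set.Icc a b, 0 ≤ g x := by
    intro g hg h x hx
    rw [← closure_Ioo hab.ne] at hx
    exact le_on_closure (f := fun _ => (0:ℝ)) h continuousOn_const hg.continuousOn hx
  by_cases h : ∃ x ∈ Set.Ioo a b, 0 < f x
  · obtain ⟨x, hx, hfx⟩ := h
    refine ⟨1, Or.inl rfl, fun y hy => ?_⟩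
    rw [one_mul]
    apply abs_of_nonneg
    apply ext f hf _ y hy
    intro y hy
    by_contra hn
    obtain ⟨w, hw, hw0⟩ := isPreconnected_Ioo.intermediate_value hy hx hf.continuousOn
      (show (0:ℝ) ∈ Set.Icc (f y) (f x) from ⟨(not_le.mp hn).le, hfx.le⟩)
    exact hz w hw hw0
  · push Not at h
    refine ⟨-1, Or.inr rfl, fun y hy => ?_⟩
    rw [neg_one_mul]
    apply abs_of_nonpos
    have := ext (fun x => - f x) hf.neg (fun x hx => by linarith [h x hx]) y hy
    linarith

lemma L1_bound (f F : ℝ → ℝ) (hf : Continuous f) (hF : ∀ t, HasDerivAt F (f t) t) (Bd : ℝ)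
    (a : ℝ) (Z : Finset ℝ) : ∀ b, a ≤ b → (∀ t ∈ Set.Icc a b, |F t| ≤ Bd) →
    (∀ t ∈ Set.Ioo a b, f t = 0 → t ∈ Z) → ∫ t in a..b, |f t| ≤ 2 * Bd * (Z.card + 1) := by
  have base : ∀ a b, a ≤ b → (∀ t ∈ Set.Icc a b, |F t| ≤ Bd) →
    (∀ t ∈ Set.Ioo a b, f t ≠ 0) → ∫ t in a..b, |f t| ≤ 2 * Bd := by
    intro a b hab hB hz
    have hB0 : 0 ≤ Bd := (abs_nonneg _).trans (hB a ⟨le_rfl, hab⟩)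
    rcases hab.eq_or_lt with h | h
    · subst h; simp; exact hB0
    obtain ⟨e, he, h2⟩ := const_sign f hf a b h hz
    have : ∫ t in a..b, |f t| = ∫ t in a..b, e * f t := by
      apply intervalIntegral.integral_congr
      intro t ht
      rw [Set.uIcc_of_le hab] at ht
      exact h2 t ht
    rw [this, intervalIntegral.integral_const_mul,
      intervalIntegral.integral_eq_sub_of_hasDerivAt (fun t _ => hF t) (hf.intervalIntegrable _ _)]
    have b1 := abs_le.mp (hB a ⟨le_rfl, hab⟩)
    have b2 := abs_le.mp (hB b ⟨hab, le_rfl⟩)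
    rcases he with rfl | rfl <;> linarith [b1.1, b1.2, b2.1, b2.2]
  induction Z using Finset.induction_on_max with
  | empty =>
    intro b hab hB hz
    have := base a b hab hB (fun t ht h => by simpa using hz t ht h)
    simpa using this
  | insert z s hs ih =>
    intro b hab hB hz
    have hns : z ∉ s := fun h => lt_irrefl _ (hs z h)
    rw [Finset.card_insert_of_notMem hns]
    have hB0 : 0 ≤ Bd := (abs_nonneg _).trans (hB a ⟨le_rfl, hab⟩)
    push_cast
    by_cases hzb : z ∈ Set.Ioo a b
    · have h1 := ih z hzb.1.le (fun t ht => hB t ⟨ht.1, ht.2.trans hzb.2.le⟩) (fun t ht h => by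
        have := hz t ⟨ht.1, ht.2.trans hzb.2⟩ h
        rcases Finset.mem_insert.mp this with h' | h'
        · exact absurd ht.2 (by rw [h']; exact lt_irrefl _)
        · exact h')
      have h2 := base z b hzb.2.le (fun t ht => hB t ⟨hzb.1.le.trans ht.1, ht.2⟩) (fun t ht h => by
        have := hz t ⟨hzb.1.trans ht.1, ht.2⟩ h
        rcases Finset.mem_insert.mp this with h' | h'
        · exact absurd ht.1 (by rw [h']; exact lt_irrefl _)
        · exact lt_asymm ht.1 (hs t h'))
      rw [← intervalIntegral.integral_add_adjacent_intervals (b := z) (hf.abs.intervalIntegrable _ _)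
        (hf.abs.intervalIntegrable _ _)]
      linarith
    · have := ih b hab hB (fun t ht h => by
        have := hz t ht h
        rcases Finset.mem_insert.mp this with h' | h'
        · exact absurd (h' ▸ ht) hzb
        · exact h')
      linarith

end LZ
open Real

namespace LZ

open Polynomial in
lemma sgnpoly (d : ℕ) : ∀ G : ℝ[X], G ≠ 0 → G.natDegree ≤ d →
    ∃ S : Finset ℝ, (∀ s ∈ S, s ∈ Set.Ioo (-1:ℝ) 1 ∧ G.eval s = 0) ∧
      ∃ e : ℝ, (e = 1 ∨ e = -1) ∧ ∀ x ∈ Set.Icc (-1:ℝ) 1, 0 ≤ e * (G.eval x * ∏ s ∈ S, (x - s)) := by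
  induction d with
  | zero =>
    intro G h0 hd
    obtain ⟨c, rfl⟩ := natDegree_eq_zero.mp (Nat.le_zero.mp hd)
    refine ⟨∅, by simp, ?_⟩
    rcases le_total 0 c with h | h
    · exact ⟨1, Or.inl rfl, by simpa using fun _ _ _ => h⟩
    · exact ⟨-1, Or.inr rfl, by simpa using fun _ _ _ => h⟩
  | succ d ih =>
    intro G h0 hd
    by_cases hr : ∃ r ∈ Set.Ioo (-1:ℝ) 1, G.eval r = 0
    · obtain ⟨r, hr, hr0⟩ := hr
      obtain ⟨G1, rfl⟩ := dvd_iff_isRoot.mpr hr0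
      have hG1 : G1 ≠ 0 := right_ne_zero_of_mul h0
      have hdeg : G1.natDegree ≤ d := by
        rw [natDegree_mul (X_sub_C_ne_zero r) hG1, natDegree_X_sub_C] at hd; omega
      obtain ⟨S, hS, e, he, hp⟩ := ih G1 hG1 hdeg
      by_cases hrS : r ∈ S
      · refine ⟨S.erase r, fun s hs => ⟨(hS s (Finset.mem_of_mem_erase hs)).1, ?_⟩, e, he, fun x hx => ?_⟩
        · simp [(hS s (Finset.mem_of_mem_erase hs)).2]
        · have := hp x hx
          rw [← Finset.mul_prod_erase S _ hrS] at this
          simp only [eval_mul, eval_sub, eval_X, eval_C]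
          exact this.trans_eq (by ring)
      · refine ⟨insert r S, fun s hs => ?_, e, he, fun x hx => ?_⟩
        · rcases Finset.mem_insert.mp hs with rfl | h
          · exact ⟨hr, hr0⟩
          · exact ⟨(hS s h).1, by simp [(hS s h).2]⟩
        · have := mul_nonneg (sq_nonneg (x - r)) (hp x hx)
          rw [Finset.prod_insert hrS]
          simp only [eval_mul, eval_sub, eval_X, eval_C]
          exact this.trans_eq (by ring)
    · push Not at hr
      obtain ⟨e, he, h⟩ := const_sign (fun x => G.eval x) G.continuous (-1) 1 (by norm_num) hr
      exact ⟨∅, by simp, e, he, fun x hx => by simp only [Finset.prod_empty, mul_one]; rw [← h x hx]; exact abs_nonneg _⟩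

open Polynomial in
lemma exists_S (A : Finset ℕ) (hA : A.Nonempty) :
    ∃ S : Finset ℝ, (∀ s ∈ S, s ∈ Set.Ioo (-1:ℝ) 1 ∧ fA A (arccos s) = 0) ∧
      ∃ e : ℝ, (e = 1 ∨ e = -1) ∧ ∀ t, 0 ≤ e * (fA A t * ∏ s ∈ S, (2 * cos t - 2 * s)) := by
  let G : ℝ[X] := ∑ n ∈ A, Chebyshev.T ℝ n
  have hG : ∀ t, G.eval (cos t) = fA A t := by
    intro t; simp [G, fA, eval_finsetSum, Chebyshev.T_real_cos]
  have h0 : G ≠ 0 := by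
    intro h
    have := hG 0
    rw [h] at this
    simp [fA] at this
    have hc := Finset.card_pos.mpr hA
    have : (A.card:ℝ) = 0 := by simpa using this.symm
    have : A.card = 0 := by exact_mod_cast this
    omega
  obtain ⟨S, hS, e, he, h⟩ := sgnpoly _ G h0 le_rfl
  refine ⟨S, fun s hs => ⟨(hS s hs).1, ?_⟩, e, he, fun t => ?_⟩
  · rw [← hG, Real.cos_arccos (hS s hs).1.1.le (hS s hs).1.2.le]; exact (hS s hs).2
  · have := mul_nonneg (pow_nonneg zero_le_two S.card : (0:ℝ) ≤ 2 ^ S.card) (h (cos t) ⟨neg_one_le_cos t, cos_le_one t⟩)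
    have e1 : ∏ s ∈ S, (2 * cos t - 2 * s) = 2 ^ S.card * ∏ s ∈ S, (cos t - s) := by
      rw [← Finset.prod_const, ← Finset.prod_mul_distrib]
      exact Finset.prod_congr rfl fun _ _ => by ring
    rw [e1, ← hG]
    exact this.trans_eq (by ring)

lemma two_cos (t : ℝ) : ((2 * cos t : ℝ) : ℂ) = ee t ^ (1:ℤ) + ee t ^ (-1:ℤ) := by
  rw [ee_zpow, ee_zpow]
  push_cast
  rw [Complex.two_cos]
  ring_nf

lemma two_cos_n (n : ℤ) (t : ℝ) : ((2 * cos (n * t) : ℝ) : ℂ) = ee t ^ n + ee t ^ (-n) := by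
  rw [ee_zpow, ee_zpow]
  push_cast
  rw [Complex.two_cos]
  ring_nf

lemma moment0 (A : Finset ℕ) (j : ℤ) :
    ‖∫ t in (0:ℝ)..(2*π), (fA A t : ℂ) * ee t ^ j‖ ≤ 2 * π := by
  have hπ := pi_pos
  have e : ∀ t, (fA A t : ℂ) * ee t ^ j = ∑ n ∈ A, ((1/2 : ℂ) * ee t ^ (n + j) + (1/2:ℂ) * ee t ^ (-(n:ℤ) + j)) := by
    intro t
    rw [fA]; push_cast
    rw [Finset.sum_mul]
    refine Finset.sum_congr rfl fun n _ => ?_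
    have := two_cos_n n t
    push_cast at this
    rw [zpow_add₀ (ee_ne t), zpow_add₀ (ee_ne t)]
    linear_combination (1/2) * ee t ^ j * this
  simp_rw [e]
  have c1 : ∀ p : ℤ, Continuous fun t => (1/2:ℂ) * ee t ^ p := fun p => (ee_zpow_cont p).const_mul _
  have c2 : ∀ n : ℕ, Continuous fun t => ((1/2 : ℂ) * ee t ^ (n + j) + (1/2:ℂ) * ee t ^ (-(n:ℤ) + j)) :=
    fun n => (c1 _).add (c1 _)
  rw [intervalIntegral.integral_finsetSum fun n _ => (c2 n).intervalIntegrable _ _]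
  have e2 : ∀ n : ℕ, ∫ t in (0:ℝ)..(2*π), ((1/2 : ℂ) * ee t ^ (n + j) + (1/2:ℂ) * ee t ^ (-(n:ℤ) + j))
      = (if (n:ℤ) = -j then (π:ℂ) else 0) + (if (n:ℤ) = j then (π:ℂ) else 0) := by
    intro n
    rw [intervalIntegral.integral_add ((c1 _).intervalIntegrable _ _) ((c1 _).intervalIntegrable _ _),
      intervalIntegral.integral_const_mul, intervalIntegral.integral_const_mul, circ_zpow, circ_zpow]
    congr 1
    · by_cases h : (n:ℤ) = -j
      · rw [if_pos (by omega), if_pos h]; ring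
      · rw [if_neg (by omega), if_neg h]; ring
    · by_cases h : (n:ℤ) = j
      · rw [if_pos (by omega), if_pos h]; ring
      · rw [if_neg (by omega), if_neg h]; ring
  simp_rw [e2]
  rw [Finset.sum_add_distrib]
  have e3 : ∀ p : ℤ, ‖∑ n ∈ A, if (n:ℤ) = p then (π:ℂ) else 0‖ ≤ π := by
    intro p
    have : ∑ n ∈ A, (if (n:ℤ) = p then (π:ℂ) else 0) = ∑ n ∈ A, (if n = p.toNat then (if 0 ≤ p then (π:ℂ) else 0) else 0) := by
      refine Finset.sum_congr rfl fun n _ => ?_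
      by_cases h : (n:ℤ) = p
      · rw [if_pos h, if_pos (by omega), if_pos (by omega)]
      · rw [if_neg h]
        split_ifs <;> first | rfl | omega
    rw [this, Finset.sum_ite_eq']
    split_ifs <;> simp [hπ.le, abs_of_pos hπ]
  refine (norm_add_le _ _).trans ?_
  linarith [e3 j, e3 (-j)]

lemma moment (A : Finset ℕ) (S : Finset ℝ) : (∀ s ∈ S, s ∈ Set.Ioo (-1:ℝ) 1) → ∀ j : ℤ,
    ‖∫ t in (0:ℝ)..(2*π), ((fA A t * ∏ s ∈ S, (2 * cos t - 2 * s) : ℝ) : ℂ) * ee t ^ j‖ ≤ 2 * π * 4 ^ S.card := by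
  classical
  induction S using Finset.induction_on with
  | empty => intro _ j; simpa using moment0 A j
  | insert r S hr ih =>
    intro hS j
    have ih := ih fun s hs => hS s (Finset.mem_insert_of_mem hs)
    set g : ℝ → ℝ := fun t => fA A t * ∏ s ∈ S, (2 * cos t - 2 * s) with hg
    have hgc : Continuous g := by
      have := fA_cont A
      fun_prop
    have c : ∀ p : ℤ, Continuous fun t => (g t : ℂ) * ee t ^ p := fun p =>
      (Complex.continuous_ofReal.comp hgc).mul (ee_zpow_cont p)
    have c' : Continuous fun t => ((2 * r : ℝ) : ℂ) * ((g t : ℂ) * ee t ^ j) := (c j).const_mul _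
    have c'' : Continuous fun t => (g t : ℂ) * ee t ^ (j+1) + (g t : ℂ) * ee t ^ (j-1) := (c _).add (c _)
    have e : ∀ t, ((fA A t * ∏ s ∈ insert r S, (2 * cos t - 2 * s) : ℝ) : ℂ) * ee t ^ j =
        (g t : ℂ) * ee t ^ (j+1) + (g t : ℂ) * ee t ^ (j-1) - ((2 * r : ℝ) : ℂ) * ((g t : ℂ) * ee t ^ j) := by
      intro t
      have e0 : fA A t * ∏ s ∈ insert r S, (2 * cos t - 2 * s) = g t * (2 * cos t - 2 * r) := by
        rw [Finset.prod_insert hr]; simp only [hg]; ring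
      rw [e0, Complex.ofReal_mul, Complex.ofReal_sub, two_cos, sub_eq_add_neg j, zpow_add₀ (ee_ne t), zpow_add₀ (ee_ne t)]
      ring
    simp_rw [e]
    rw [intervalIntegral.integral_sub (c''.intervalIntegrable _ _) (c'.intervalIntegrable _ _),
      intervalIntegral.integral_add ((c _).intervalIntegrable _ _) ((c _).intervalIntegrable _ _),
      intervalIntegral.integral_const_mul]
    have h1 := ih (j+1)
    have h2 := ih (j-1)
    have h3 := ih j
    have hr1 := hS r (by simp)
    have hr2 : |2 * r| ≤ 2 := by rw [abs_le]; constructor <;> linarith [hr1.1, hr1.2]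
    refine (norm_sub_le _ _).trans ?_
    have h4 := norm_add_le (∫ t in (0:ℝ)..(2*π), (g t : ℂ) * ee t ^ (j+1)) (∫ t in (0:ℝ)..(2*π), (g t : ℂ) * ee t ^ (j-1))
    rw [norm_mul, Complex.norm_real, Real.norm_eq_abs, Finset.card_insert_of_notMem hr, pow_succ]
    have h5 := mul_le_mul hr2 h3 (norm_nonneg _) (by norm_num)
    linarith

open Polynomial in
lemma exists_q (S : Finset ℝ) : ∃ q : ℕ → ℝ, q 0 = 1 ∧ q (2 * S.card) = 1 ∧
    ∀ t, ∑ j ∈ Finset.range (2 * S.card + 1), (q j : ℂ) * ee t ^ j =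
      ee t ^ S.card * ((∏ s ∈ S, (2 * cos t - 2 * s) : ℝ) : ℂ) := by
  let p : ℝ → ℝ[X] := fun s => X ^ 2 + (C (-2*s) * X + C 1)
  have hd : ∀ s, (C (-2*s) * X + C 1 : ℝ[X]).degree < ((2:ℕ) : WithBot ℕ) := fun s =>
    lt_of_le_of_lt degree_linear_le (by norm_num)
  have hm : ∀ s, (p s).Monic := fun s => monic_X_pow_add (hd s)
  have hdeg : ∀ s, (p s).natDegree = 2 := fun s => natDegree_eq_of_degree_eq_some (by
    rw [degree_add_eq_left_of_degree_lt (by rw [degree_X_pow]; exact hd s), degree_X_pow])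
  let q : ℝ[X] := ∏ s ∈ S, p s
  have hqm : q.Monic := monic_prod_of_monic _ _ fun s _ => hm s
  have hqd : q.natDegree = 2 * S.card := by
    rw [natDegree_prod_of_monic _ _ fun s _ => hm s]; simp [hdeg, mul_comm]
  refine ⟨q.coeff, ?_, ?_, fun t => ?_⟩
  · rw [coeff_zero_eq_eval_zero]; simp [q, p, eval_prod]
  · rw [← hqd]; exact hqm
  · have h1 := aeval_eq_sum_range (p := q) (ee t)
    rw [hqd] at h1
    have h2 : ∑ j ∈ Finset.range (2 * S.card + 1), (q.coeff j : ℂ) * ee t ^ j = aeval (ee t) q := by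
      rw [h1]; exact Finset.sum_congr rfl fun j _ => by rw [Complex.real_smul]
    rw [h2, map_prod, Complex.ofReal_prod, ← Finset.prod_const, ← Finset.prod_mul_distrib]
    refine Finset.prod_congr rfl fun s _ => ?_
    rw [Complex.ofReal_sub, two_cos]
    have := ee_ne t
    simp [p]
    field_simp
    ring

lemma dirichlet (d T : ℕ) (hT : 0 < T) (x : ℕ → ℝ) :
    ∃ Q : ℕ, 1 ≤ Q ∧ Q ≤ T ^ d ∧ ∃ w : ℕ → ℤ, ∀ j < d, |Q * x j - w j| ≤ 1 / T := by
  classical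
  have hT' : (0:ℝ) < T := by exact_mod_cast hT
  let φ : ℕ → (Fin d → Fin T) := fun n j => ⟨⌊T * Int.fract (n * x j)⌋₊, by
    rw [Nat.floor_lt (by have := Int.fract_nonneg (n * x j); positivity)]
    have := Int.fract_lt_one (n * x j)
    nlinarith⟩
  have : ∃ a ∈ Finset.range (T^d+1), ∃ b ∈ Finset.range (T^d+1), a ≠ b ∧ φ a = φ b := by
    apply Finset.exists_ne_map_eq_of_card_lt_of_maps_to (t := Finset.univ)
    · simp
    · intro a _; simp
  obtain ⟨a, ha, b, hb, hne, heq⟩ := this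
  have main : ∀ a b : ℕ, a < T^d+1 → b < T^d+1 → a < b → φ a = φ b →
      ∃ Q : ℕ, 1 ≤ Q ∧ Q ≤ T ^ d ∧ ∃ w : ℕ → ℤ, ∀ j < d, |Q * x j - w j| ≤ 1 / T := by
    intro a b ha hb hab heq
    refine ⟨b - a, by omega, by omega, fun j => ⌊b * x j⌋ - ⌊a * x j⌋, fun j hj => ?_⟩
    have h1 := congrArg Fin.val (congrFun heq ⟨j, hj⟩)
    simp only [φ] at h1
    have ga := Int.fract_nonneg (a * x j)
    have gb := Int.fract_nonneg (b * x j)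
    have a1 := Nat.floor_le (mul_nonneg hT'.le ga)
    have a2 := Nat.lt_floor_add_one (T * Int.fract (a * x j))
    have b1 := Nat.floor_le (mul_nonneg hT'.le gb)
    have b2 := Nat.lt_floor_add_one (T * Int.fract (b * x j))
    rw [← h1] at b1 b2
    have e : ((b - a : ℕ):ℝ) * x j - ((⌊b * x j⌋ - ⌊a * x j⌋ : ℤ) : ℝ) = Int.fract (b * x j) - Int.fract (a * x j) := by
      rw [Nat.cast_sub hab.le, Int.fract, Int.fract]; push_cast; ring
    rw [e, abs_le, le_div_iff₀ hT', neg_le_iff_add_nonneg, ]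
    constructor
    · have : 0 ≤ T * (Int.fract (b * x j) - Int.fract (a * x j) + 1/T) := by
        have : T * (Int.fract (b * x j) - Int.fract (a * x j) + 1/T) = T * Int.fract (b * x j) - T * Int.fract (a * x j) + 1 := by
          field_simp
        rw [this]; linarith
      exact nonneg_of_mul_nonneg_right this hT'
    · linarith
  simp only [Finset.mem_range] at ha hb
  rcases lt_or_gt_of_ne hne with h | h
  · exact main a b ha hb h heq
  · exact main b a hb ha h heq.symm

end LZ
open Real

namespace LZ

lemma stepC (A : Finset ℕ) (hA : A.Nonempty) (Z : Finset ℝ)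
    (hZ : ∀ t ∈ Set.Icc 0 (2 * π), fA A t = 0 → t ∈ Z) (T : ℕ) (hT : 2 ≤ T) :
    ∃ k ≤ Z.card, ∃ w : ℕ → ℤ, w 0 ≠ 0 ∧ w (2 * k) ≠ 0 ∧ ∃ Bad : Finset ℤ,
      (∀ n : ℕ, 2 * k + 1 ≤ n → (n:ℤ) ∉ Bad →
        ∑ j ∈ Finset.range (2 * k + 1), w j * (if n - j ∈ A then 1 else 0) = 0) ∧
      ∀ J : ℕ, 4 ^ J ≤ Bad.card → π * J ≤ 64 * ((T:ℝ) ^ (2 * k + 1) * (2 * π * 4 ^ k) +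
        (∫ t in (0:ℝ)..(2*π), |fA A t|) * ((2 * k + 1) / T)) := by
  classical
  have hπ := pi_pos
  have h2π : (0:ℝ) ≤ 2 * π := by positivity
  obtain ⟨S, hS, e, he, hpos⟩ := exists_S A hA
  obtain ⟨q, hq0, hqk, hq⟩ := exists_q S
  set k := S.card with hk
  obtain ⟨Q, hQ1, hQT, w, hw⟩ := dirichlet (2 * k + 1) T (by omega) q
  have hTr : (2:ℝ) ≤ T := by exact_mod_cast hT
  have hT1 : (1:ℝ) / T < 1 := by rw [div_lt_one (by linarith)]; linarith
  have hwQ : ∀ j < 2 * k + 1, q j = 1 → w j ≠ 0 := by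
    intro j hj h1 h0
    have := hw j hj
    rw [h1, h0] at this
    simp at this
    have : (Q:ℝ) < 1 := by rw [one_div] at hT1; linarith
    have : Q < 1 := by exact_mod_cast this
    omega
  refine ⟨k, ?_, w, hwQ 0 (by omega) hq0, hwQ _ (by omega) hqk, ?_⟩
  · apply Finset.card_le_card_of_injOn arccos
    · intro s hs
      apply hZ _ ⟨arccos_nonneg s, (arccos_le_pi s).trans (by linarith)⟩ (hS s hs).2
    · intro x hx y hy h
      have hx := (hS x hx).1
      have hy := (hS y hy).1
      exact arccos_injOn ⟨hx.1.le, hx.2.le⟩ ⟨hy.1.le, hy.2.le⟩ h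
  let M : ℕ := A.sup id
  have hM : ∀ n ∈ A, n ≤ M := fun n hn => Finset.le_sup (f := id) hn
  let U : Finset ℤ := Finset.Icc (-(M:ℤ)) (M + 2 * k)
  let c : ℤ → ℤ := fun x => ∑ j ∈ Finset.range (2 * k + 1), w j *
    ∑ n ∈ A, ((if x = n + j then 1 else 0) + (if x = -(n:ℤ) + j then 1 else 0))
  let Bad : Finset ℤ := U.filter fun x => c x ≠ 0
  have hU : ∀ n ∈ A, ∀ j ∈ Finset.range (2 * k + 1), (n + j : ℤ) ∈ U ∧ (-(n:ℤ) + j) ∈ U := by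
    intro n hn j hj
    have := hM n hn
    simp [U] at hj ⊢; omega
  have hexp : ∀ t, ∑ x ∈ Bad, (c x : ℂ) * ee t ^ x =
      2 * (fA A t : ℂ) * ∑ j ∈ Finset.range (2 * k + 1), (w j : ℂ) * ee t ^ j := by
    intro t
    have s1 : ∑ x ∈ Bad, (c x : ℂ) * ee t ^ x = ∑ x ∈ U, (c x : ℂ) * ee t ^ x := by
      apply Finset.sum_subset (Finset.filter_subset _ _)
      intro x hx hxn
      simp only [Bad, Finset.mem_filter, not_and, not_not] at hxn
      rw [hxn hx]; simp
    rw [s1]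
    have s2 : ∀ x ∈ U, (c x : ℂ) * ee t ^ x = ∑ j ∈ Finset.range (2 * k + 1), ∑ n ∈ A,
        (w j : ℂ) * ((if x = n + j then ee t ^ x else 0) + (if x = -(n:ℤ) + j then ee t ^ x else 0)) := by
      intro x _
      simp only [c]
      push_cast
      rw [Finset.sum_mul]
      refine Finset.sum_congr rfl fun j _ => ?_
      rw [mul_assoc, Finset.sum_mul, Finset.mul_sum]
      refine Finset.sum_congr rfl fun n _ => ?_
      rw [add_mul, ite_mul, ite_mul]; simp
    rw [Finset.sum_congr rfl s2, Finset.sum_comm, Finset.mul_sum]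
    refine Finset.sum_congr rfl fun j hj => ?_
    rw [Finset.sum_comm]
    have s3 : ∀ n ∈ A, ∑ x ∈ U, (w j : ℂ) * ((if x = n + j then ee t ^ x else 0) + (if x = -(n:ℤ) + j then ee t ^ x else 0))
        = (w j : ℂ) * (((2 * cos (n * t) : ℝ) : ℂ) * ee t ^ j) := by
      intro n hn
      obtain ⟨u1, u2⟩ := hU n hn j hj
      rw [← Finset.mul_sum, Finset.sum_add_distrib, Finset.sum_ite_eq', Finset.sum_ite_eq', if_pos u1, if_pos u2]
      have := two_cos_n n t
      rw [Int.cast_natCast] at this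
      rw [this, zpow_add₀ (ee_ne t), zpow_add₀ (ee_ne t), zpow_natCast _ j]
      ring
    rw [Finset.sum_congr rfl s3, ← Finset.mul_sum, ← Finset.sum_mul]
    have : ∑ i ∈ A, ((2 * cos (i * t) : ℝ) : ℂ) = 2 * (fA A t : ℂ) := by
      rw [fA, ← Complex.ofReal_sum, ← Finset.mul_sum]; push_cast; rfl
    rw [this]; ring
  refine ⟨Bad, ?_, ?_⟩
  · intro n hn hnB
    have hc0 : c n = 0 := by
      by_cases hnU : (n:ℤ) ∈ U
      · simp only [Bad, Finset.mem_filter, not_and, not_not] at hnB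
        exact hnB hnU
      · apply Finset.sum_eq_zero
        intro j hj
        rw [Finset.sum_eq_zero, mul_zero]
        intro y hy
        obtain ⟨u1, u2⟩ := hU y hy j hj
        have g1 : ¬ (n:ℤ) = y + j := fun h => hnU (by rw [h]; exact u1)
        have g2 : ¬ (n:ℤ) = -(y:ℤ) + j := fun h => hnU (by rw [h]; exact u2)
        rw [if_neg g1, if_neg g2]; rfl
    refine Eq.trans ?_ hc0
    refine Finset.sum_congr rfl fun j hj => ?_
    congr 1
    have hj := Finset.mem_range.mp hj
    have : ∀ y ∈ A, ((if (n:ℤ) = y + j then 1 else 0) + (if (n:ℤ) = -(y:ℤ) + j then 1 else 0) : ℤ) = if y = n - j then 1 else 0 := by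
      intro y _
      rw [if_neg (by omega : ¬ (n:ℤ) = -(y:ℤ) + j), add_zero]
      by_cases h : y = n - j
      · rw [if_pos h, if_pos (by omega)]
      · rw [if_neg h, if_neg (by omega)]
    rw [Finset.sum_congr rfl this, Finset.sum_ite_eq']
  · intro J hJ
    have h1 := mps J Bad hJ (fun x => (c x : ℂ)) (by
      intro x hx
      have : c x ≠ 0 := (Finset.mem_filter.mp hx).2
      rw [Complex.norm_intCast]
      exact_mod_cast Int.one_le_abs this)
    refine h1.trans ?_
    have hfc := fA_cont A
    set P : ℝ → ℝ := fun t => ∏ s ∈ S, (2 * cos t - 2 * s) with hP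
    have hPc : Continuous P := by fun_prop
    have bd : ∀ t, ‖∑ x ∈ Bad, (c x : ℂ) * ee t ^ x‖ ≤ 2 * Q * (e * (fA A t * P t)) + 2 * ((2 * k + 1) / T) * |fA A t| := by
      intro t
      rw [hexp, norm_mul, norm_mul, Complex.norm_real, Real.norm_eq_abs]
      have b1 : ∑ j ∈ Finset.range (2 * k + 1), (w j : ℂ) * ee t ^ j =
          Q * (ee t ^ k * (P t : ℂ)) - ∑ j ∈ Finset.range (2 * k + 1), ((Q * q j - w j : ℝ) : ℂ) * ee t ^ j := by
        rw [← hq t, Finset.mul_sum, ← Finset.sum_sub_distrib]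
        refine Finset.sum_congr rfl fun j _ => ?_
        push_cast; ring
      have b2 : ‖∑ j ∈ Finset.range (2 * k + 1), ((Q * q j - w j : ℝ) : ℂ) * ee t ^ j‖ ≤ (2 * k + 1) / T := by
        refine (norm_sum_le _ _).trans ?_
        have : ∀ j ∈ Finset.range (2 * k + 1), ‖((Q * q j - w j : ℝ) : ℂ) * ee t ^ j‖ ≤ 1 / T := by
          intro j hj
          rw [norm_mul, norm_pow, ee_norm, one_pow, mul_one, Complex.norm_real, Real.norm_eq_abs]
          exact hw j (Finset.mem_range.mp hj)
        refine (Finset.sum_le_sum this).trans (le_of_eq ?_)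
        rw [Finset.sum_const, Finset.card_range, nsmul_eq_mul]; push_cast; ring
      have b3 : ‖∑ j ∈ Finset.range (2 * k + 1), (w j : ℂ) * ee t ^ j‖ ≤ Q * |P t| + (2 * k + 1) / T := by
        rw [b1]
        refine (norm_sub_le _ _).trans (add_le_add ?_ b2)
        rw [norm_mul, norm_mul, norm_pow, ee_norm, one_pow, one_mul, Complex.norm_real, Complex.norm_natCast, Real.norm_eq_abs]
      have b4 : e * (fA A t * P t) = |fA A t| * |P t| := by
        rw [← abs_mul, ← abs_of_nonneg (hpos t), abs_mul e]
        rcases he with rfl | rfl <;> simp [hP]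
      rw [b4]
      have := mul_le_mul_of_nonneg_left b3 (by positivity : 0 ≤ 2 * |fA A t|)
      rw [show ‖(2:ℂ)‖ = 2 by simp]
      linarith
    have c1 : Continuous fun t => ‖∑ x ∈ Bad, (c x : ℂ) * ee t ^ x‖ :=
      (continuous_finsetSum _ fun x _ => (ee_zpow_cont x).const_mul _).norm
    have c2 : Continuous fun t => 2 * Q * (e * (fA A t * P t)) := by fun_prop
    have c3 : Continuous fun t => 2 * ((2 * k + 1) / T) * |fA A t| := by fun_prop
    have c4 : Continuous fun t => 2 * Q * (e * (fA A t * P t)) + 2 * ((2 * k + 1) / T) * |fA A t| := c2.add c3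
    have I1 := intervalIntegral.integral_mono_on (μ := MeasureTheory.volume) h2π (c1.intervalIntegrable _ _) (c4.intervalIntegrable _ _) (fun t _ => bd t)
    rw [intervalIntegral.integral_add (c2.intervalIntegrable _ _) (c3.intervalIntegrable _ _),
      intervalIntegral.integral_const_mul, intervalIntegral.integral_const_mul, intervalIntegral.integral_const_mul] at I1
    have I2 : e * ∫ t in (0:ℝ)..(2*π), fA A t * P t ≤ 2 * π * 4 ^ k := by
      have m := moment A S (fun s hs => (hS s hs).1) 0
      simp only [zpow_zero, mul_one] at m
      rw [intervalIntegral.integral_ofReal, Complex.norm_real, Real.norm_eq_abs] at m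
      have := abs_le.mp m
      rcases he with rfl | rfl
      · linarith [this.2]
      · linarith [this.1]
    have I3 : (Q:ℝ) * (e * ∫ t in (0:ℝ)..(2*π), fA A t * P t) ≤ (T:ℝ) ^ (2 * k + 1) * (2 * π * 4 ^ k) := by
      have hQ' : (Q:ℝ) ≤ (T:ℝ) ^ (2 * k + 1) := by exact_mod_cast hQT
      calc _ ≤ (Q:ℝ) * (2 * π * 4 ^ k) := mul_le_mul_of_nonneg_left I2 (by positivity)
        _ ≤ _ := mul_le_mul_of_nonneg_right hQ' (by positivity)
    linarith

end LZ
open Real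

namespace LZ

lemma prop_zero (A : Finset ℕ) (k : ℕ) (w : ℕ → ℤ) (hw0 : w 0 ≠ 0) (hwk : w (2 * k) ≠ 0)
    (x l y : ℕ)
    (hrec : ∀ n, x ≤ n → n < x + l →
        ∑ j ∈ Finset.range (2 * k + 1), w j * (if n - j ∈ A then 1 else 0) = 0)
    (hx : 2 * k + 1 ≤ x) (hy : x ≤ y) (hyl : y + 2 * k ≤ x + l) (hz : ∀ i < 2 * k, y + i ∉ A) :
    ∀ n, x ≤ n → n < x + l → n ∉ A := by
  have up : ∀ n, y ≤ n → n < x + l → n ∉ A := by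
    intro n
    induction n using Nat.strong_induction_on with
    | _ n ih =>
      intro h1 h2 hA
      by_cases h : n < y + 2 * k
      · have := hz (n - y) (by omega)
        rw [Nat.add_sub_cancel' h1] at this
        exact this hA
      · have := hrec n (by omega) h2
        rw [Finset.sum_eq_single 0] at this
        · simp [hA, hw0] at this
        · intro j hj hj0
          have := Finset.mem_range.mp hj
          rw [if_neg (ih (n - j) (by omega) (by omega) (by omega)), mul_zero]
        · simp
  have down : ∀ d, x + d ≤ y → ∀ n, y - d ≤ n → n < x + l → n ∉ A := by
    intro d
    induction d with
    | zero => intro _ n h1 h2; exact up n (by omega) h2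
    | succ d ih =>
      intro hd n h1 h2 hA
      have ih := ih (by omega)
      by_cases h : y - d ≤ n
      · exact ih n h h2 hA
      · have := hrec (n + 2 * k) (by omega) (by omega)
        rw [Finset.sum_eq_single (2 * k)] at this
        · simp [hA, hwk] at this
        · intro j hj hj0
          have := Finset.mem_range.mp hj
          rw [if_neg (ih (n + 2 * k - j) (by omega) (by omega)), mul_zero]
        · simp
  intro n h1 h2
  exact down (y - x) (by omega) n (by omega) h2

lemma stepD (A : Finset ℕ) (k : ℕ) (w : ℕ → ℤ) (hw0 : w 0 ≠ 0) (hwk : w (2 * k) ≠ 0) (Bad : Finset ℤ)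
    (hBad : ∀ n : ℕ, 2 * k + 1 ≤ n → (n:ℤ) ∉ Bad →
        ∑ j ∈ Finset.range (2 * k + 1), w j * (if n - j ∈ A then 1 else 0) = 0)
    (D : ℕ) (hD : 2 * k + 1 ≤ D) (l' : ℕ) (hl' : 1 ≤ l')
    (hN : D + Bad.card * (D * l') < A.card) :
    ∃ x d : ℕ, 1 ≤ x ∧ l' ≤ (A ∩ Finset.Ico x (x + D * l')).card ∧
      A ∩ Finset.Ico (x + d) (x + d + D * l') = ∅ ∧ d ≤ (Bad.card + 1) * (D * l') := by
  classical
  set l := D * l' with hl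
  have hl0 : 0 < l := Nat.mul_pos (by omega) hl'
  let BB : Finset ℕ := Bad.image fun b => (b.toNat - D) / l
  have hBB : BB.card ≤ Bad.card := Finset.card_image_le
  have good : ∀ i ∉ BB, ∀ n, D + i * l ≤ n → n < D + i * l + l →
      ∑ j ∈ Finset.range (2 * k + 1), w j * (if n - j ∈ A then 1 else 0) = 0 := by
    intro i hi n h1 h2
    apply hBad n (by omega)
    intro hb
    apply hi
    refine Finset.mem_image.mpr ⟨n, hb, ?_⟩
    rw [Int.toNat_natCast]
    apply Nat.div_eq_of_lt_le
    · omega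
    · rw [Nat.succ_mul]; omega
  let Good : Finset ℕ := ((A.filter (D ≤ ·)).image fun n => (n - D) / l) \ BB
  have hGood : Good.Nonempty := by
    by_contra hne
    rw [Finset.not_nonempty_iff_eq_empty, Finset.sdiff_eq_empty_iff_subset] at hne
    have hsub : A ⊆ Finset.range D ∪ BB.biUnion fun i => Finset.Ico (D + i * l) (D + i * l + l) := by
      intro n hn
      by_cases h : n < D
      · simp [h]
      · apply Finset.mem_union_right
        refine Finset.mem_biUnion.mpr ⟨(n - D) / l, hne (Finset.mem_image.mpr ⟨n, by simp; exact ⟨hn, by omega⟩, rfl⟩), ?_⟩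
        have h1 := Nat.div_add_mod (n - D) l
        have h2 := Nat.mod_lt (n - D) hl0
        rw [mul_comm] at h1
        rw [Finset.mem_Ico]; omega
    have h1 := Finset.card_le_card hsub
    have h2 := Finset.card_union_le (Finset.range D) (BB.biUnion fun i => Finset.Ico (D + i * l) (D + i * l + l))
    have h3 : (BB.biUnion fun i => Finset.Ico (D + i * l) (D + i * l + l)).card ≤ BB.card * l :=
      Finset.card_biUnion_le_card_mul _ _ _ fun i _ => by simp
    have h4 : BB.card * l ≤ Bad.card * l := Nat.mul_le_mul_right _ hBB
    rw [Finset.card_range] at h2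
    omega
  set i0 := Good.max' hGood with hi0
  have hi0m : i0 ∈ Good := Finset.max'_mem _ _
  obtain ⟨i1, hi1, hi1B⟩ : ∃ i ∈ Finset.Ioc i0 (i0 + (Bad.card + 1)), i ∉ BB := by
    by_contra hh
    push Not at hh
    have := Finset.card_le_card (show Finset.Ioc i0 (i0 + (Bad.card + 1)) ⊆ BB from hh)
    simp at this; omega
  rw [Finset.mem_Ioc] at hi1
  have hi1G : i1 ∉ Good := fun h => by
    have := Finset.le_max' Good i1 h
    omega
  obtain ⟨him, hiB⟩ := Finset.mem_sdiff.mp hi0m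
  obtain ⟨n0, hn0, hn0i⟩ := Finset.mem_image.mp him
  rw [Finset.mem_filter] at hn0
  refine ⟨D + i0 * l, (i1 - i0) * l, by omega, ?_, ?_, ?_⟩
  · have sub : ∀ i < l', ∃ a ∈ A, D + i0 * l + i * D ≤ a ∧ a < D + i0 * l + i * D + D := by
      intro i hi
      by_contra hh
      push Not at hh
      have hil : i * D + D ≤ l := by
        have : (i+1) * D ≤ l' * D := Nat.mul_le_mul_right _ hi
        rw [Nat.succ_mul, mul_comm l'] at this; exact this
      have := prop_zero A k w hw0 hwk (D + i0 * l) l (D + i0 * l + i * D) (good i0 hiB) (by omega) (by omega)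
        (by omega) (fun j hj hA => by
          have := hh _ hA (by omega); omega)
      have h1 := Nat.div_add_mod (n0 - D) l
      have h2 := Nat.mod_lt (n0 - D) hl0
      have h1' : l * ((n0 - D) / l) = i0 * l := by rw [← hn0i]; ring
      exact this n0 (by omega) (by omega) hn0.1
    choose! a haA ha1 ha2 using sub
    have : ((Finset.range l').image a).card = l' := by
      rw [Finset.card_image_of_injOn, Finset.card_range]
      intro i hi j hj hij
      have hi := Finset.mem_range.mp hi
      have hj := Finset.mem_range.mp hj
      rcases lt_trichotomy i j with h | h | h
      · have : (i+1) * D ≤ j * D := Nat.mul_le_mul_right _ h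
        rw [Nat.succ_mul] at this
        have := ha2 i hi; have := ha1 j hj
        omega
      · exact h
      · have : (j+1) * D ≤ i * D := Nat.mul_le_mul_right _ h
        rw [Nat.succ_mul] at this
        have := ha2 j hj; have := ha1 i hi
        omega
    rw [← this]
    apply Finset.card_le_card
    intro y hy
    obtain ⟨i, hi, rfl⟩ := Finset.mem_image.mp hy
    have hi := Finset.mem_range.mp hi
    have hil : i * D + D ≤ l := by
      have : (i+1) * D ≤ l' * D := Nat.mul_le_mul_right _ hi
      rw [Nat.succ_mul, mul_comm l'] at this; exact this
    have := ha1 i hi; have := ha2 i hi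
    rw [Finset.mem_inter, Finset.mem_Ico]
    exact ⟨haA i hi, by omega, by omega⟩
  · have e : D + i0 * l + (i1 - i0) * l = D + i1 * l := by
      rw [add_assoc, ← Nat.add_mul]; congr 2; omega
    rw [e]
    rw [Finset.eq_empty_iff_forall_notMem]
    intro n hn
    rw [Finset.mem_inter, Finset.mem_Ico] at hn
    apply hi1G
    refine Finset.mem_sdiff.mpr ⟨Finset.mem_image.mpr ⟨n, by simp; exact ⟨hn.1, by omega⟩, ?_⟩, hi1B⟩
    apply Nat.div_eq_of_lt_le
    · omega
    · rw [Nat.succ_mul]; omega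
  · apply Nat.mul_le_mul_right; omega

end LZ
open Real

namespace LZ

noncomputable def GA (A : Finset ℕ) (s : ℝ) : ℝ :=
  ∑ n ∈ A, if n = 0 then s ^ 2 / 2 else (1 - Real.cos (n * s)) / n ^ 2

lemma GA_deriv (A : Finset ℕ) (t : ℝ) : HasDerivAt (GA A) (FA A t) t := by
  unfold GA FA
  apply HasDerivAt.fun_sum
  intro n _
  split_ifs with h
  · have := ((hasDerivAt_id' t).fun_pow 2).div_const 2
    simpa using this
  · have hn : (n:ℝ) ≠ 0 := by exact_mod_cast h
    have h1 : HasDerivAt (fun t : ℝ => (n:ℝ) * t) n t := by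
      simpa using (hasDerivAt_id' t).const_mul (n:ℝ)
    have := ((h1.cos).const_sub 1).div_const ((n:ℝ)^2)
    have e : -(-sin (n * t) * n) / (n:ℝ)^2 = sin (n * t) / n := by field_simp
    rw [e] at this
    exact this

lemma GA_nonneg (A : Finset ℕ) (s : ℝ) : 0 ≤ GA A s := by
  apply Finset.sum_nonneg
  intro n _
  split_ifs
  · positivity
  · have := cos_le_one (n * s)
    apply div_nonneg <;> [linarith; positivity]

open Polynomial in
lemma bern2 (x : ℝ) : (Polynomial.map (algebraMap ℚ ℝ) (Polynomial.bernoulli (2*1))).eval x = x^2-x+1/6 := by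
  simp [Polynomial.bernoulli, Finset.sum_range_succ, _root_.bernoulli, bernoulli'_two]
  ring

lemma GA_le (A : Finset ℕ) (s : ℝ) (hs0 : 0 ≤ s) (hs : s ≤ 2) : GA A s ≤ 3 * s := by
  have hπ := pi_gt_three
  have hπ' := pi_lt_four
  have h1 := hasSum_one_div_nat_pow_mul_cos (k := 1) one_ne_zero (x := s / (2 * π)) ⟨by positivity, by
    rw [div_le_one (by positivity)]; linarith⟩
  rw [bern2] at h1
  have h2 := hasSum_zeta_two.sub h1
  have e : ∀ n : ℕ, 1 / (n:ℝ)^2 - 1 / (n:ℝ)^(2*1) * cos (2 * π * n * (s / (2 * π))) = (1 - cos (n * s)) / n^2 := by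
    intro n
    have : 2 * π * n * (s / (2 * π)) = n * s := by field_simp
    rw [this]; ring
  simp_rw [e] at h2
  have v : π ^ 2 / 6 - (-1) ^ (1 + 1) * (2 * π) ^ (2 * 1) / 2 / ((2 * 1).factorial : ℝ) * ((s / (2 * π)) ^ 2 - s / (2 * π) + 1 / 6)
      = π * s / 2 - s ^ 2 / 4 := by
    simp [Nat.factorial]; field_simp; ring
  rw [v] at h2
  have nn : ∀ n : ℕ, 0 ≤ (1 - cos (n * s)) / (n:ℝ)^2 := by
    intro n
    have := cos_le_one (n * s)
    apply div_nonneg <;> [linarith; positivity]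
  have h3 : ∑ n ∈ A.erase 0, (1 - cos (n * s)) / (n:ℝ)^2 ≤ π * s / 2 - s ^ 2 / 4 := sum_le_hasSum _ (fun n _ => nn n) h2
  have h4 : GA A s ≤ (∑ n ∈ A.erase 0, (1 - cos (n * s)) / (n:ℝ)^2) + s ^ 2 / 2 := by
    have e : ∑ n ∈ A.erase 0, (1 - cos (n * s)) / (n:ℝ)^2 = ∑ n ∈ A.erase 0, if n = 0 then s ^ 2 / 2 else (1 - Real.cos (n * s)) / n ^ 2 := by
      refine Finset.sum_congr rfl fun n hn => ?_
      rw [if_neg (Finset.ne_of_mem_erase hn)]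
    rw [e]
    unfold GA
    by_cases h : 0 ∈ A
    · rw [← Finset.sum_erase_add A _ h]; simp
    · rw [Finset.erase_eq_of_notMem h]
      have : 0 ≤ s ^ 2 / 2 := by positivity
      linarith
  nlinarith

lemma upper (A : Finset ℕ) (a b : ℝ) (ha : 0 < a) (hab : a ≤ b) (hb : b ≤ 1)
    (hz : ∀ t ∈ Set.Ioo (a/2) (2*b), fA A t ≠ 0) : ∫ t in a..b, |fA A t| ≤ 9 := by
  obtain ⟨e, he, hs⟩ := const_sign (fA A) (fA_cont A) (a/2) (2*b) (by linarith) hz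
  have hFc : Continuous (FA A) := continuous_iff_continuousAt.mpr fun t => (FA_deriv A t).continuousAt
  have hint : ∀ x y : ℝ, a/2 ≤ x → x ≤ y → y ≤ 2 * b → ∫ t in x..y, |fA A t| = e * (FA A y - FA A x) := by
    intro x y hx hxy hy
    have : ∫ t in x..y, |fA A t| = ∫ t in x..y, e * fA A t := by
      apply intervalIntegral.integral_congr
      intro t ht
      rw [Set.uIcc_of_le hxy] at ht
      exact hs t ⟨hx.trans ht.1, ht.2.trans hy⟩
    rw [this, intervalIntegral.integral_const_mul,
      intervalIntegral.integral_eq_sub_of_hasDerivAt (fun t _ => FA_deriv A t) ((fA_cont A).intervalIntegrable _ _)]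
  have hmono : ∀ x y : ℝ, a/2 ≤ x → x ≤ y → y ≤ 2 * b → e * FA A x ≤ e * FA A y := by
    intro x y hx hxy hy
    have h1 := hint x y hx hxy hy
    have h2 : 0 ≤ ∫ t in x..y, |fA A t| := intervalIntegral.integral_nonneg hxy fun _ _ => abs_nonneg _
    linarith
  have hG : ∀ x y : ℝ, ∫ t in x..y, e * FA A t = e * (GA A y - GA A x) := by
    intro x y
    rw [intervalIntegral.integral_const_mul,
      intervalIntegral.integral_eq_sub_of_hasDerivAt (fun t _ => GA_deriv A t) (hFc.intervalIntegrable _ _)]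
  have hFc' : Continuous fun t => e * FA A t := hFc.const_mul e
  have u1 : b * (e * FA A b) ≤ e * (GA A (2*b) - GA A b) := by
    rw [← hG]
    have := intervalIntegral.integral_mono_on (μ := MeasureTheory.volume) (a := b) (b := 2*b) (by linarith)
      (f := fun _ => e * FA A b) (g := fun t => e * FA A t) (continuous_const.intervalIntegrable _ _) (hFc'.intervalIntegrable _ _)
      (fun t ht => hmono b t (by linarith) ht.1 ht.2)
    rw [intervalIntegral.integral_const, smul_eq_mul] at this
    linarith
  have u2 : e * (GA A a - GA A (a/2)) ≤ a/2 * (e * FA A a) := by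
    rw [← hG]
    have := intervalIntegral.integral_mono_on (μ := MeasureTheory.volume) (a := a/2) (b := a) (by linarith)
      (f := fun t => e * FA A t) (g := fun _ => e * FA A a) (hFc'.intervalIntegrable _ _) (continuous_const.intervalIntegrable _ _)
      (fun t ht => hmono t a ht.1 ht.2 (by linarith))
    rw [intervalIntegral.integral_const, smul_eq_mul] at this
    linarith
  rw [hint a b (by linarith) hab (by linarith), mul_sub]
  have g1 := GA_nonneg A (2*b)
  have g2 := GA_nonneg A b
  have g3 := GA_nonneg A a
  have g4 := GA_nonneg A (a/2)
  have k1 := GA_le A (2*b) (by linarith) (by linarith)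
  have k2 := GA_le A b (by linarith) (by linarith)
  have k3 := GA_le A a (by linarith) (by linarith)
  have k4 := GA_le A (a/2) (by linarith) (by linarith)
  have hb0 : 0 < b := by linarith
  rcases he with rfl | rfl
  · have v1 : b * (1 * FA A b) ≤ b * 6 := by linarith
    have v2 : a * (-3) ≤ a * (1 * FA A a) := by linarith
    have := le_of_mul_le_mul_left v1 hb0
    have := le_of_mul_le_mul_left v2 ha
    linarith
  · have v1 : b * (-1 * FA A b) ≤ b * 3 := by linarith
    have v2 : a * (-6) ≤ a * (-1 * FA A a) := by linarith
    have := le_of_mul_le_mul_left v1 hb0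
    have := le_of_mul_le_mul_left v2 ha
    linarith

lemma int_cos (p : ℤ) : ∫ t in (0:ℝ)..π, cos (p * t) = if p = 0 then π else 0 := by
  split_ifs with h
  · subst h; simp
  · have hp : (p:ℝ) ≠ 0 := by exact_mod_cast h
    have : ∀ t, HasDerivAt (fun t : ℝ => sin (p * t) / p) (cos (p * t)) t := by
      intro t
      have h1 : HasDerivAt (fun t : ℝ => (p:ℝ) * t) p t := by
        simpa using (hasDerivAt_id' t).const_mul (p:ℝ)
      have := (h1.sin).div_const (p:ℝ)
      rw [mul_div_cancel_right₀ _ hp] at this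
      exact this
    rw [intervalIntegral.integral_eq_sub_of_hasDerivAt (fun t _ => this t)
      (Continuous.intervalIntegrable (by fun_prop) _ _)]
    simp [Real.sin_int_mul_pi]

lemma int_f_cos (A : Finset ℕ) (y : ℕ) (hy : 1 ≤ y) :
    ∫ t in (0:ℝ)..π, fA A t * cos (y * t) = if y ∈ A then π / 2 else 0 := by
  have e : ∀ t, fA A t * cos (y * t) = ∑ n ∈ A, (1/2 * cos (((n:ℤ) - (y:ℤ) : ℤ) * t) + 1/2 * cos (((n:ℤ)+(y:ℤ) : ℤ) * t)) := by
    intro t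
    rw [fA, Finset.sum_mul]
    refine Finset.sum_congr rfl fun n _ => ?_
    push_cast
    rw [sub_mul, add_mul, cos_add, cos_sub]; ring
  simp_rw [e]
  have c1 : ∀ p : ℤ, Continuous fun t : ℝ => 1/2 * cos (p * t) := fun p => by fun_prop
  have c2 : ∀ p q : ℤ, Continuous fun t : ℝ => 1/2 * cos (p * t) + 1/2 * cos (q * t) := fun p q => by fun_prop
  rw [intervalIntegral.integral_finsetSum fun n _ => (c2 _ _).intervalIntegrable _ _]
  have e2 : ∀ n ∈ A, ∫ t in (0:ℝ)..π, (1/2 * cos (((n:ℤ) - (y:ℤ) : ℤ) * t) + 1/2 * cos (((n:ℤ)+(y:ℤ) : ℤ) * t))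
      = if n = y then π/2 else 0 := by
    intro n _
    rw [intervalIntegral.integral_add ((c1 _).intervalIntegrable _ _) ((c1 _).intervalIntegrable _ _),
      intervalIntegral.integral_const_mul, intervalIntegral.integral_const_mul, int_cos, int_cos,
      if_neg (by omega : ¬ (n:ℤ) + (y:ℤ) = 0)]
    by_cases h : n = y
    · rw [if_pos (by omega), if_pos h]; ring
    · rw [if_neg (by omega), if_neg h]; ring
  rw [Finset.sum_congr rfl e2, Finset.sum_ite_eq']

lemma dir_sum (x l : ℕ) (t : ℝ) :
    2 * sin (t/2) * ∑ y ∈ Finset.Ico x (x + l), cos (y * t) = sin ((x + l - 1/2) * t) - sin ((x - 1/2) * t) := by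
  induction l with
  | zero => simp
  | succ l ih =>
    rw [← add_assoc, Finset.sum_Ico_succ_top (by omega), mul_add, ih]
    have e1 : ((x:ℝ) + (l+1:ℕ) - 1/2) * t = ((x + l : ℕ):ℝ) * t + t/2 := by push_cast; ring
    have e2 : ((x:ℝ) + l - 1/2) * t = ((x + l : ℕ):ℝ) * t - t/2 := by push_cast; ring
    rw [e1, e2, sin_add, sin_sub]; ring

lemma dir_bound (x l : ℕ) (t : ℝ) (ht : 0 < t) (ht' : t ≤ π) :
    |∑ y ∈ Finset.Ico x (x + l), cos (y * t)| ≤ π / t := by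
  have h := dir_sum x l t
  have h1 := mul_le_sin (x := t/2) (by linarith) (by linarith)
  have hπ := pi_pos
  have h2 : |2 * sin (t/2) * ∑ y ∈ Finset.Ico x (x + l), cos (y * t)| ≤ 2 := by
    rw [h]
    have a1 := abs_sin_le_one ((x + l - 1/2) * t)
    have a2 := abs_sin_le_one ((x - 1/2) * t)
    have := abs_sub (sin ((x + l - 1/2) * t)) (sin ((x - 1/2) * t))
    linarith
  have h3 : 0 < 2 / π * (t/2) := by positivity
  rw [abs_mul, abs_mul, abs_of_pos (by linarith : 0 < sin (t/2)), abs_two] at h2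
  have h4 : 2 / π * (t/2) * |∑ y ∈ Finset.Ico x (x + l), cos (y * t)| ≤ 1 := by
    have := mul_le_mul_of_nonneg_right h1 (abs_nonneg (∑ y ∈ Finset.Ico x (x + l), cos (y * t)))
    linarith
  rw [le_div_iff₀ ht]
  have e : 2 / π * (t/2) * |∑ y ∈ Finset.Ico x (x + l), cos (y * t)| = |∑ y ∈ Finset.Ico x (x + l), cos (y * t)| * t / π := by
    field_simp
  rw [e, div_le_one hπ] at h4
  exact h4

end LZ
open Real

namespace LZ

lemma lower (A : Finset ℕ) (x d D l' : ℕ) (hx : 1 ≤ x) (hD : 1 ≤ D) (hl' : 1 ≤ l')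
    (h1 : l' ≤ (A ∩ Finset.Ico x (x + D * l')).card)
    (h2 : A ∩ Finset.Ico (x + d) (x + d + D * l') = ∅) (B : ℝ)
    (hB : ∫ t in (0:ℝ)..π, |fA A t| ≤ B) (a b : ℝ) (ha : 0 < a) (hab : a ≤ b) (hb : b ≤ π) :
    π / (2 * D) ≤ 2 * (∫ t in a..b, |fA A t|) + B * (d * a + 2 * π / (D * l' * b)) := by
  classical
  have hπ := pi_pos
  set l := D * l' with hl
  have hl0 : 0 < l := Nat.mul_pos hD hl'
  have hl0r : (0:ℝ) < l := by exact_mod_cast hl0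
  have hf := fA_cont A
  let J := Finset.Ico x (x + l)
  let S : ℝ → ℝ := fun t => ∑ y ∈ J, (cos (y * t) - cos ((y + d : ℕ) * t))
  have hSc : Continuous S := by fun_prop
  -- the integral
  have hI : ∫ t in (0:ℝ)..π, fA A t * S t = π / 2 * (A ∩ J).card := by
    have e : ∀ t, fA A t * S t = ∑ y ∈ J, (fA A t * cos (y * t) - fA A t * cos ((y + d : ℕ) * t)) := by
      intro t; simp only [S]; rw [Finset.mul_sum]; exact Finset.sum_congr rfl fun y _ => by ring
    simp_rw [e]
    have c1 : ∀ y : ℕ, Continuous fun t => fA A t * cos (y * t) := fun y => by fun_prop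
    have c2 : ∀ y z : ℕ, Continuous fun t => fA A t * cos (y * t) - fA A t * cos (z * t) := fun y z => by fun_prop
    rw [intervalIntegral.integral_finsetSum fun n _ => (c2 _ _).intervalIntegrable _ _]
    have e2 : ∀ y ∈ J, ∫ t in (0:ℝ)..π, (fA A t * cos (y * t) - fA A t * cos ((y + d : ℕ) * t)) = if y ∈ A then π/2 else 0 := by
      intro y hy
      have hy := Finset.mem_Ico.mp hy
      rw [intervalIntegral.integral_sub ((c1 _).intervalIntegrable _ _) ((c1 _).intervalIntegrable _ _),
        int_f_cos A y (by omega), int_f_cos A (y + d) (by omega), if_neg (?_ : y + d ∉ A), sub_zero]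
      intro hA
      have : y + d ∈ A ∩ Finset.Ico (x + d) (x + d + l) := by
        rw [Finset.mem_inter, Finset.mem_Ico]; exact ⟨hA, by omega, by omega⟩
      rw [h2] at this; simp at this
    rw [Finset.sum_congr rfl e2, ← Finset.sum_filter, Finset.sum_const, nsmul_eq_mul, Finset.filter_mem_eq_inter,
      Finset.inter_comm]
    ring
  have hcard : (J.card : ℝ) = l := by simp [J]
  have b1 : ∀ t, 0 ≤ t → |S t| ≤ l * (d * t) := by
    intro t ht
    refine (Finset.abs_sum_le_sum_abs _ _).trans ?_
    have : ∀ y ∈ J, |cos (y * t) - cos ((y + d : ℕ) * t)| ≤ d * t := by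
      intro y _
      refine (abs_cos_sub_cos_le _ _).trans (le_of_eq ?_)
      have : (y:ℝ) * t - (y + d : ℕ) * t = -(d * t) := by push_cast; ring
      rw [this, abs_neg, abs_of_nonneg (by positivity)]
    refine (Finset.sum_le_card_nsmul _ _ _ this).trans (le_of_eq ?_)
    rw [nsmul_eq_mul, hcard]
  have b2 : ∀ t, |S t| ≤ l * 2 := by
    intro t
    refine (Finset.abs_sum_le_sum_abs _ _).trans ?_
    have : ∀ y ∈ J, |cos (y * t) - cos ((y + d : ℕ) * t)| ≤ 2 := by
      intro y _
      have := abs_sub (cos (y * t)) (cos ((y + d : ℕ) * t))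
      linarith [abs_cos_le_one (y * t), abs_cos_le_one ((y + d : ℕ) * t)]
    refine (Finset.sum_le_card_nsmul _ _ _ this).trans (le_of_eq ?_)
    rw [nsmul_eq_mul, hcard]
  have b3 : ∀ t, 0 < t → t ≤ π → |S t| ≤ 2 * (π / t) := by
    intro t ht ht'
    have e : S t = ∑ y ∈ Finset.Ico x (x + l), cos (y * t) - ∑ y ∈ Finset.Ico (x + d) (x + d + l), cos (y * t) := by
      simp only [S, J]
      rw [Finset.sum_sub_distrib]
      congr 1
      rw [show x + d + l = (x + l) + d by ring]
      exact Finset.sum_Ico_add' (fun y : ℕ => cos (y * t)) x (x + l) d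
    rw [e]
    have := abs_sub (∑ y ∈ Finset.Ico x (x + l), cos (y * t)) (∑ y ∈ Finset.Ico (x + d) (x + d + l), cos (y * t))
    linarith [dir_bound x l t ht ht', dir_bound (x + d) l t ht ht']
  have hfi : ∀ u v : ℝ, IntervalIntegrable (fun t => |fA A t|) MeasureTheory.volume u v := fun u v => hf.abs.intervalIntegrable _ _
  have hpiece : ∀ u v C : ℝ, u ≤ v → (∀ t ∈ Set.Icc u v, |S t| ≤ C) →
      ∫ t in u..v, fA A t * S t ≤ C * ∫ t in u..v, |fA A t| := by
    intro u v C huv h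
    rw [← intervalIntegral.integral_const_mul]
    have c1 : Continuous fun t => fA A t * S t := by fun_prop
    have c2 : Continuous fun t => C * |fA A t| := by fun_prop
    apply intervalIntegral.integral_mono_on huv (c1.intervalIntegrable _ _) (c2.intervalIntegrable _ _)
    intro t ht
    have := le_abs_self (fA A t * S t)
    rw [abs_mul] at this
    have := mul_le_mul_of_nonneg_left (h t ht) (abs_nonneg (fA A t))
    linarith
  have c0 : Continuous fun t => fA A t * S t := by fun_prop
  have hb0 : 0 < b := by linarith
  have p1 := hpiece 0 a (l * (d * a)) ha.le (fun t ht => (b1 t ht.1).trans (by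
    have := ht.2; gcongr))
  have p2 := hpiece a b (l * 2) hab (fun t _ => b2 t)
  have p3 := hpiece b π (2 * (π / b)) hb (fun t ht => (b3 t (by linarith [ht.1]) ht.2).trans (by
    have := ht.1; gcongr))
  have n0 : ∀ u v : ℝ, u ≤ v → 0 ≤ ∫ t in u..v, |fA A t| := fun u v h => intervalIntegral.integral_nonneg h fun _ _ => abs_nonneg _
  have s1 : ∫ t in (0:ℝ)..π, |fA A t| = (∫ t in (0:ℝ)..a, |fA A t|) + (∫ t in a..b, |fA A t|) + ∫ t in b..π, |fA A t| := by
    rw [intervalIntegral.integral_add_adjacent_intervals (hfi _ _) (hfi _ _),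
      intervalIntegral.integral_add_adjacent_intervals (hfi _ _) (hfi _ _)]
  have s2 : ∫ t in (0:ℝ)..π, fA A t * S t = (∫ t in (0:ℝ)..a, fA A t * S t) + (∫ t in a..b, fA A t * S t) + ∫ t in b..π, fA A t * S t := by
    rw [intervalIntegral.integral_add_adjacent_intervals (c0.intervalIntegrable _ _) (c0.intervalIntegrable _ _),
      intervalIntegral.integral_add_adjacent_intervals (c0.intervalIntegrable _ _) (c0.intervalIntegrable _ _)]
  have n1 := n0 0 a ha.le
  have n2 := n0 a b hab
  have n3 := n0 b π hb
  have q1 : l * (d * a) * (∫ t in (0:ℝ)..a, |fA A t|) ≤ l * (d * a) * B :=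
    mul_le_mul_of_nonneg_left (by linarith) (by positivity)
  have q3 : 2 * (π / b) * (∫ t in b..π, |fA A t|) ≤ 2 * (π / b) * B :=
    mul_le_mul_of_nonneg_left (by linarith) (by positivity)
  have hc1 : (l':ℝ) ≤ (A ∩ J).card := by exact_mod_cast h1
  have f1 : π / 2 * l' ≤ l * (d * a) * B + l * 2 * (∫ t in a..b, |fA A t|) + 2 * (π / b) * B := by
    have := mul_le_mul_of_nonneg_left hc1 (by positivity : 0 ≤ π / 2)
    linarith
  have hDr : (0:ℝ) < D := by exact_mod_cast hD
  have hl'r : (0:ℝ) < l' := by exact_mod_cast hl'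
  have hlr : (l:ℝ) = D * l' := by rw [hl]; push_cast; ring
  have g : l * (π / (2 * D)) ≤ l * (2 * (∫ t in a..b, |fA A t|) + B * (d * a + 2 * π / (D * l' * b))) := by
    have e1 : l * (π / (2 * D)) = π / 2 * l' := by rw [hlr]; field_simp
    have e2 : l * (2 * (∫ t in a..b, |fA A t|) + B * (d * a + 2 * π / (D * l' * b))) =
        l * (d * a) * B + l * 2 * (∫ t in a..b, |fA A t|) + 2 * (π / b) * B * (l / (D * l')) := by ring
    rw [e1, e2, hlr, div_self (by positivity), mul_one, ← hlr]
    exact f1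
  exact le_of_mul_le_mul_left g hl0r

end LZ
open Real

namespace LZ

set_option maxHeartbeats 4000000 in
lemma main1 (A : Finset ℕ) (hA : A.Nonempty) (Z : Finset ℝ)
    (hZ : ∀ t ∈ Set.Icc 0 (2 * π), fA A t = 0 → t ∈ Z) (K : ℕ) (hK : Z.card ≤ K) (B : ℝ) (hB1 : 1 ≤ B)
    (hB : ∫ t in (0:ℝ)..(2*π), |fA A t| ≤ B) (T : ℕ) (hT : 2 ≤ T) :
    ∃ k ≤ K, ∃ m : ℕ, (∀ J : ℕ, 4 ^ J ≤ m → π * J ≤ 64 * ((T:ℝ) ^ (2 * k + 1) * (2 * π * 4 ^ k) +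
        B * ((2 * k + 1) / T))) ∧
      (A.card : ℝ) < (46 * (2 * K + 1) ^ 2 * B ^ 2 * (m + 1)) ^ ((K + 1) * (24 * (2 * K + 1) + 2)) := by
  classical
  have hπ := pi_gt_three
  obtain ⟨k, hkZ, w, hw0, hwk, Bad, hBad, hmps⟩ := stepC A hA Z hZ T hT
  have hTr : (0:ℝ) < T := by exact_mod_cast (by omega : 0 < T)
  refine ⟨k, hkZ.trans hK, Bad.card, ?_, ?_⟩
  · intro J hJ
    refine (hmps J hJ).trans ?_
    have : (∫ t in (0:ℝ)..(2*π), |fA A t|) * ((2 * k + 1) / T) ≤ B * ((2 * k + 1) / T) :=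
      mul_le_mul_of_nonneg_right hB (by positivity)
    linarith
  by_contra hcon
  rw [not_lt] at hcon
  set m := Bad.card with hm
  set D : ℕ := 2 * K + 1 with hD
  have hDr : (D:ℝ) = 2 * K + 1 := by rw [hD]; push_cast; ring
  rw [← hDr] at hcon
  set L : ℕ := 24 * D with hL
  set E : ℕ := (K + 1) * (L + 2) with hE
  set r : ℝ := 46 * (D:ℝ) ^ 2 * B ^ 2 * (m + 1) with hr
  have hD1 : (1:ℝ) ≤ D := by rw [hDr]; have : (0:ℝ) ≤ K := by positivity
                             linarith
  have hm0 : (1:ℝ) ≤ m + 1 := by have : (0:ℝ) ≤ m := by positivity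
                                 linarith
  have hr17 : 17 * D * B * (m + 1) < r := by
    have h1 : 1 ≤ D * B := by nlinarith
    have h2 : 0 < D * B * (m + 1) := by positivity
    have : r = 46 * (D * B * (m + 1)) * (D * B) := by rw [hr]; ring
    rw [this]; nlinarith
  have hr2 : 2 ≤ r := by
    have h1 : 1 ≤ D * B := by nlinarith
    have : 1 ≤ D * B * (m+1) := by nlinarith
    linarith
  have hr0 : 0 < r := by linarith
  let θ : ℕ → ℝ := fun j => 1 / r ^ j
  have hθ0 : ∀ j, 0 < θ j := fun j => by positivity
  have hθ1 : ∀ j, θ j ≤ 1 := fun j => by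
    simp only [θ]; rw [div_le_one (by positivity)]; exact one_le_pow₀ (by linarith)
  have hθs : ∀ j, θ (j+1) * r = θ j := fun j => by
    simp only [θ]; rw [pow_succ]; field_simp
  have hθ2 : ∀ j, 2 * θ (j+1) ≤ θ j := fun j => by
    rw [← hθs j]; nlinarith [hθ0 (j+1)]
  have hθa : Antitone θ := antitone_nat_of_succ_le fun j => by linarith [hθ2 j, hθ0 (j+1)]
  have hBπ : ∫ t in (0:ℝ)..π, |fA A t| ≤ B := by
    have hfi : ∀ u v : ℝ, IntervalIntegrable (fun t => |fA A t|) MeasureTheory.volume u v :=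
      fun u v => (fA_cont A).abs.intervalIntegrable _ _
    have h1 := intervalIntegral.integral_add_adjacent_intervals (hfi 0 π) (hfi π (2*π))
    have h2 : 0 ≤ ∫ t in π..(2*π), |fA A t| := intervalIntegral.integral_nonneg (by linarith) fun _ _ => abs_nonneg _
    linarith
  have hlow : ∀ j, j + 1 ≤ E → π / (8 * D) ≤ ∫ t in (θ (j+1))..(θ j), |fA A t| := by
    intro j hj
    have hrj : (1:ℝ) ≤ r ^ j := one_le_pow₀ (by linarith)
    set l' : ℕ := ⌈16 * B * r ^ j⌉₊ with hl'
    have hBr : 1 ≤ B * r ^ j := by nlinarith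
    have l1 : 16 * B * r ^ j ≤ l' := Nat.le_ceil _
    have l2 : (l':ℝ) ≤ 17 * B * r ^ j := by
      have := Nat.ceil_lt_add_one (by positivity : 0 ≤ 16 * B * r ^ j)
      linarith
    have l3 : 1 ≤ l' := by
      have : (1:ℝ) ≤ l' := by linarith
      exact_mod_cast this
    have hN : D + m * (D * l') < A.card := by
      have : (D:ℝ) + m * (D * l') < A.card := by
        calc (D:ℝ) + m * (D * l') ≤ D * (17 * B * r ^ j) + m * (D * (17 * B * r ^ j)) := by
              apply add_le_add
              · have : 1 ≤ 17 * B * r ^ j := by linarith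
                nlinarith
              · gcongr
          _ = (17 * D * B * (m + 1)) * r ^ j := by ring
          _ < r * r ^ j := mul_lt_mul_of_pos_right hr17 (by positivity)
          _ = r ^ (j+1) := by ring
          _ ≤ r ^ E := pow_le_pow_right₀ (by linarith) hj
          _ ≤ A.card := hcon
      exact_mod_cast this
    obtain ⟨x, d, hx, hx1, hx2, hd⟩ := stepD A k w hw0 hwk Bad hBad D (by omega) l' l3 hN
    have hlo := lower A x d D l' hx (by omega) l3 hx1 hx2 B hBπ (θ (j+1)) (θ j) (hθ0 _) (hθa (by omega))
      ((hθ1 j).trans (by linarith))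
    have hdr : (d:ℝ) ≤ (m + 1) * (D * l') := by exact_mod_cast hd
    have z1 : B * (d * θ (j+1)) ≤ π / (8 * D) := by
      have : (d:ℝ) * θ (j+1) ≤ (m+1) * (D * (17 * B * r ^ j)) * θ (j+1) := by
        apply mul_le_mul_of_nonneg_right _ (hθ0 _).le
        refine hdr.trans ?_
        gcongr
      have e : B * ((m+1) * (D * (17 * B * r ^ j)) * θ (j+1)) = 17 / 46 / D := by
        have : θ (j+1) = 1 / (r * r ^ j) := by simp only [θ]; rw [pow_succ, mul_comm]
        rw [this]
        have hmm : ((m:ℝ)+1) ≠ 0 := by linarith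
        have hBB : B ≠ 0 := by linarith
        have hDD : (D:ℝ) ≠ 0 := by linarith
        have hrr : r ^ j ≠ 0 := by positivity
        rw [show r * r ^ j = 46 * (D:ℝ) ^ 2 * B ^ 2 * (m + 1) * r ^ j by rw [hr]]
        field_simp
      have : B * (d * θ (j+1)) ≤ 17 / 46 / D := by
        rw [← e]; exact mul_le_mul_of_nonneg_left this (by linarith)
      refine this.trans ?_
      rw [← div_div]
      apply div_le_div_of_nonneg_right _ (by linarith)
      linarith
    have z2 : B * (2 * π / (D * l' * θ j)) ≤ π / (8 * D) := by
      have h16 : 16 * B ≤ l' * θ j := by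
        simp only [θ]
        rw [mul_one_div, le_div_iff₀ (by positivity)]; exact l1
      have hp : 0 < l' * θ j := by linarith
      rw [mul_assoc (D:ℝ), mul_div_assoc', div_le_div_iff₀ (by positivity) (by positivity)]
      have : 0 ≤ π * D := by positivity
      nlinarith [mul_le_mul_of_nonneg_left h16 this]
    rw [mul_add] at hlo
    have e4 : π / (2 * D) = 4 * (π / (8 * D)) := by field_simp; norm_num
    linarith
  -- a zero-free group
  obtain ⟨g, hgK, hg⟩ : ∃ g < K + 1, ∀ t ∈ Set.Ioo (θ ((g+1)*(L+2))) (θ (g*(L+2))), fA A t ≠ 0 := by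
    by_contra hh
    push Not at hh
    choose! z hz hz0 using hh
    have hinj : ∀ g g', g < K + 1 → g' < K + 1 → g < g' → z g' < z g := by
      intro g g' hg hg' hgg
      have h1 := (hz g' hg').2
      have h2 := (hz g hg).1
      have h3 : θ (g' * (L+2)) ≤ θ ((g+1)*(L+2)) := hθa (Nat.mul_le_mul_right _ hgg)
      linarith
    have : (Finset.range (K+1)).card ≤ Z.card := by
      apply Finset.card_le_card_of_injOn z
      · intro g hg
        have hg := Finset.mem_range.mp hg
        have h1 := hz g hg
        apply hZ _ ⟨_, _⟩ (hz0 g hg)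
        · linarith [h1.1, hθ0 ((g+1)*(L+2))]
        · linarith [h1.2, hθ1 (g*(L+2))]
      · intro g hg g' hg' h
        have hg := Finset.mem_range.mp hg
        have hg' := Finset.mem_range.mp hg'
        rcases lt_trichotomy g g' with h' | h' | h'
        · have := hinj g g' hg hg' h'; linarith
        · exact h'
        · have := hinj g' g hg' hg h'; linarith
    rw [Finset.card_range] at this
    omega
  have hgE : (g + 1) * (L + 2) ≤ E := Nat.mul_le_mul_right _ hgK
  have hge : (g + 1) * (L + 2) = g * (L + 2) + L + 2 := by ring
  set p := g * (L + 2) + 1 with hp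
  have hsum : ∀ i ≤ L, i * (π / (8 * D)) ≤ ∫ t in (θ (p + i))..(θ p), |fA A t| := by
    intro i
    induction i with
    | zero => simp
    | succ i ih =>
      intro hi
      have h1 := ih (by omega)
      have h2 := hlow (p + i) (by omega)
      have hfi : ∀ u v : ℝ, IntervalIntegrable (fun t => |fA A t|) MeasureTheory.volume u v :=
        fun u v => (fA_cont A).abs.intervalIntegrable _ _
      rw [← intervalIntegral.integral_add_adjacent_intervals (hfi _ (θ (p + i))) (hfi _ _)]
      push_cast
      rw [← add_assoc]
      linarith
  have hup := upper A (θ (p + L)) (θ p) (hθ0 _) (hθa (by omega)) (hθ1 _) (by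
    intro t ht
    apply hg t
    constructor
    · have := hθ2 (p + L)
      have e : (g+1)*(L+2) = p + L + 1 := by omega
      rw [e]
      linarith [ht.1]
    · have := hθ2 (g * (L+2))
      exact lt_of_lt_of_le ht.2 this)
  have h1 := hsum L le_rfl
  have e : (L:ℝ) * (π / (8 * D)) = 3 * π := by
    rw [hL]; push_cast; field_simp; norm_num
  rw [e] at h1
  have := pi_gt_d2
  linarith

end LZ
open Real

namespace LZ

open Polynomial in
lemma zeros_finite (A : Finset ℕ) (hA : A.Nonempty) :
    {t : ℝ | t ∈ Set.Icc 0 (2 * π) ∧ fA A t = 0}.Finite := by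
  let G : ℝ[X] := ∑ n ∈ A, Chebyshev.T ℝ n
  have hG : ∀ t, G.eval (cos t) = fA A t := by
    intro t; simp [G, fA, eval_finsetSum, Chebyshev.T_real_cos]
  have h0 : G ≠ 0 := by
    intro h
    have := hG 0
    rw [h] at this
    simp [fA] at this
    have hc := Finset.card_pos.mpr hA
    have : (A.card:ℝ) = 0 := by simpa using this.symm
    have : A.card = 0 := by exact_mod_cast this
    omega
  have hf : (G.rootSet ℝ).Finite := G.rootSet_finite ℝ
  apply ((hf.image arccos).union (hf.image fun r => 2 * π - arccos r)).subset
  rintro t ⟨⟨h1, h2⟩, h3⟩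
  have hr : cos t ∈ G.rootSet ℝ := by
    rw [mem_rootSet]
    refine ⟨h0, ?_⟩
    rw [coe_aeval_eq_eval, hG, h3]
  rcases le_total t π with h | h
  · left; exact ⟨cos t, hr, arccos_cos h1 h⟩
  · right
    refine ⟨cos t, hr, ?_⟩
    simp only
    rw [← cos_two_pi_sub t, arccos_cos (by linarith) (by linarith)]; ring

lemma main2 (A : Finset ℕ) (Z : Finset ℝ)
    (hZ : ∀ t ∈ Set.Icc 0 (2 * π), fA A t = 0 → t ∈ Z) (K : ℕ) (hK1 : 1 ≤ K) (hK : Z.card ≤ K)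
    (hl : 1 ≤ Real.log A.card)
    (hc : 177600 * (K:ℝ) ^ 2 * ((2727936 * (K:ℝ) ^ 4) ^ (2 * K + 1) * 4 ^ K) ≤ Real.log A.card) : False := by
  have hπ := pi_gt_three
  have hπ2 := pi_lt_d2
  have hA : A.Nonempty := by
    rw [← Finset.card_pos]
    by_contra h
    have : A.card = 0 := by omega
    rw [this] at hl; simp at hl; linarith
  set ℓ := Real.log A.card with hℓ
  have hKr : (1:ℝ) ≤ K := by exact_mod_cast hK1
  set B : ℝ := 36 * K * ℓ with hBdef
  have hKl : 1 ≤ K * ℓ := by nlinarith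
  have hB1 : 1 ≤ B := by rw [hBdef]; nlinarith
  have hB : ∫ t in (0:ℝ)..(2*π), |fA A t| ≤ B := by
    have h := L1_bound (fA A) (FA A) (fA_cont A) (FA_deriv A) (9 * ℓ) 0 Z (2*π) (by linarith)
      (by
        intro t ht
        refine (FA_bound A t).trans ?_
        rw [abs_of_nonneg ht.1]
        have := ht.2
        linarith)
      (fun t ht h => hZ t ⟨ht.1.le, ht.2.le⟩ h)
    refine h.trans ?_
    have hzk : (Z.card:ℝ) ≤ K := by exact_mod_cast hK
    have : (Z.card:ℝ) + 1 ≤ 2 * K := by linarith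
    have := mul_le_mul_of_nonneg_left this (by linarith : 0 ≤ 2 * (9 * ℓ))
    rw [hBdef]; linarith
  set T : ℕ := 2727936 * K ^ 4 with hT
  have hK4 : 1 ≤ K ^ 4 := Nat.one_le_pow _ _ hK1
  have hTr : (T:ℝ) = 2727936 * (K:ℝ) ^ 4 := by rw [hT]; push_cast; ring
  rw [← hTr] at hc
  have hT1 : (1:ℝ) ≤ T := by exact_mod_cast (by omega : 1 ≤ T)
  obtain ⟨k, hk, m, hm, hN⟩ := main1 A hA Z hZ K hK B hB1 hB T (by omega)
  have hkr : (k:ℝ) ≤ K := by exact_mod_cast hk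
  set M : ℝ := (T:ℝ) ^ (2 * K + 1) * 4 ^ K with hM
  have hTM : (T:ℝ) ≤ M := by
    have a1 : (T:ℝ) ^ 1 ≤ (T:ℝ) ^ (2 * K + 1) := pow_le_pow_right₀ hT1 (by omega)
    have a2 : (1:ℝ) ≤ 4 ^ K := one_le_pow₀ (by norm_num)
    rw [pow_one] at a1
    rw [hM]; nlinarith
  have hM1 : 1 ≤ M := hT1.trans hTM
  have hJ : ∀ J : ℕ, 4 ^ J ≤ m → (J:ℝ) ≤ 128 * M + 2304 * K ^ 2 * ℓ / T := by
    intro J hJ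
    have h := hm J hJ
    have b1 : (T:ℝ) ^ (2 * k + 1) * (2 * π * 4 ^ k) ≤ 2 * π * M := by
      have : (T:ℝ) ^ (2 * k + 1) * 4 ^ k ≤ M := by
        rw [hM]
        exact mul_le_mul (pow_le_pow_right₀ hT1 (by omega)) (pow_le_pow_right₀ (by norm_num) hk)
          (by positivity) (by positivity)
      have := mul_le_mul_of_nonneg_left this (by linarith : 0 ≤ 2 * π)
      linarith
    have b2 : B * ((2 * k + 1) / T) ≤ 108 * (K ^ 2 * ℓ / T) := by
      have : B * (2 * k + 1) ≤ 108 * (K ^ 2 * ℓ) := by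
        have : (2 * k + 1 : ℝ) ≤ 3 * K := by linarith
        have := mul_le_mul_of_nonneg_left this (by linarith : 0 ≤ B)
        refine this.trans (le_of_eq ?_)
        rw [hBdef]; ring
      rw [← mul_div_assoc, ← mul_div_assoc]
      exact div_le_div_of_nonneg_right this (by linarith)
    have b3 : 0 ≤ K ^ 2 * ℓ / T := by positivity
    have b4 : π * J ≤ π * (128 * M + 2304 * K ^ 2 * ℓ / T) := by
      have e : π * (128 * M + 2304 * K ^ 2 * ℓ / T) = 64 * (2 * π * M) + 2304 * π * (K ^ 2 * ℓ / T) := by ring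
      rw [e]
      nlinarith
    exact le_of_mul_le_mul_left b4 pi_pos
  have hlm : Real.log (m + 1) ≤ 2 * (128 * M + 2304 * K ^ 2 * ℓ / T + 1) := by
    have b3 : 0 ≤ 2304 * K ^ 2 * ℓ / T := by positivity
    rcases Nat.eq_zero_or_pos m with h0 | h0
    · rw [h0]; simp; linarith
    have h1 := hJ (Nat.log 4 m) (Nat.pow_log_le_self 4 (by omega))
    have h2 : m + 1 ≤ 4 ^ (Nat.log 4 m + 1) := Nat.lt_pow_succ_log_self (by norm_num) m
    have h3 : ((m:ℝ) + 1) ≤ 4 ^ (Nat.log 4 m + 1) := by exact_mod_cast h2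
    have h4 := Real.log_le_log (by positivity) h3
    rw [Real.log_pow] at h4
    have h5 : Real.log 4 ≤ 2 := by
      have : (4:ℝ) = 2 ^ 2 := by norm_num
      rw [this, Real.log_pow]
      have := Real.log_two_lt_d9
      push_cast; linarith
    push_cast at h4
    refine h4.trans ?_
    have h6 : (0:ℝ) ≤ (Nat.log 4 m : ℝ) + 1 := by positivity
    nlinarith
  have hs : Real.log ℓ ≤ 2 * √ℓ := by
    have h1 := Real.log_le_sub_one_of_pos (Real.sqrt_pos.mpr (by linarith : 0 < ℓ))
    have h2 : Real.log ℓ = 2 * Real.log √ℓ := by rw [Real.log_sqrt (by linarith)]; ring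
    linarith
  set E : ℕ := (K + 1) * (24 * (2 * K + 1) + 2) with hE
  have hEr : (E:ℝ) ≤ 148 * K ^ 2 := by
    rw [hE]; push_cast; nlinarith
  have hCB : Real.log (46 * (2 * K + 1) ^ 2 * B ^ 2) ≤ 16 + 4 * K + 2 * Real.log ℓ := by
    have h1 : 46 * (2 * K + 1) ^ 2 * B ^ 2 ≤ 536544 * (K:ℝ) ^ 4 * ℓ ^ 2 := by
      have : (2 * K + 1 : ℝ) ^ 2 ≤ (3 * K) ^ 2 := pow_le_pow_left₀ (by positivity) (by linarith) 2
      have := mul_le_mul_of_nonneg_right this (by positivity : 0 ≤ 46 * B ^ 2)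
      calc 46 * (2 * K + 1) ^ 2 * B ^ 2 = (2 * K + 1) ^ 2 * (46 * B ^ 2) := by ring
        _ ≤ _ := this
        _ = _ := by rw [hBdef]; ring
    have h2 := Real.log_le_log (by positivity) h1
    have h2' : Real.log (536544 * (K:ℝ) ^ 4 * ℓ ^ 2) = Real.log 536544 + 4 * Real.log K + 2 * Real.log ℓ := by
      rw [Real.log_mul (by positivity) (by positivity), Real.log_mul (by positivity) (by positivity),
        Real.log_pow, Real.log_pow]
      push_cast; ring
    rw [h2'] at h2
    have h3 := Real.log_le_sub_one_of_pos (by linarith : (0:ℝ) < K)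
    have h4 : Real.log 536544 ≤ 16 := by
      have : Real.log 536544 ≤ Real.log (2 ^ 20) := Real.log_le_log (by norm_num) (by norm_num)
      rw [Real.log_pow] at this
      have := Real.log_two_lt_d9
      push_cast at *; linarith
    linarith
  have hfin : ℓ < E * (Real.log (46 * (2 * K + 1) ^ 2 * B ^ 2) + Real.log (m + 1)) := by
    have h1 := Real.log_lt_log (by exact_mod_cast Finset.card_pos.mpr hA) hN
    rw [Real.log_pow, Real.log_mul (by positivity) (by positivity)] at h1
    exact h1
  have hKT : (K:ℝ) ≤ T := by
    rw [hTr]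
    have : (K:ℝ) ^ 1 ≤ (K:ℝ) ^ 4 := pow_le_pow_right₀ hKr (by norm_num)
    linarith
  have hsq : 2368 * (K:ℝ) ^ 2 ≤ √ℓ := by
    apply Real.le_sqrt_of_sq_le
    have h2 : (1:ℝ) ≤ K ^ 2 := one_le_pow₀ hKr
    have h3 : M ≤ K ^ 2 * M := by nlinarith
    have : (2368 * (K:ℝ) ^ 2) ^ 2 = 5607424 * K ^ 4 := by ring
    rw [this]
    have : 0 ≤ (K:ℝ) ^ 4 := by positivity
    linarith
  have hlast : 148 * (K:ℝ) ^ 2 * (2 * (2304 * K ^ 2 * ℓ / T)) = ℓ / 4 := by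
    rw [hTr]; field_simp; norm_num
  have hss : √ℓ * √ℓ = ℓ := Real.mul_self_sqrt (by linarith)
  have htot : Real.log (46 * (2 * K + 1) ^ 2 * B ^ 2) + Real.log (m + 1) ≤
      300 * M + 4 * √ℓ + 2 * (2304 * K ^ 2 * ℓ / T) := by linarith
  have hpos : 0 ≤ 300 * M + 4 * √ℓ + 2 * (2304 * K ^ 2 * ℓ / T) := by positivity
  have h8 : ℓ < 148 * K ^ 2 * (300 * M + 4 * √ℓ + 2 * (2304 * K ^ 2 * ℓ / T)) :=
    hfin.trans_le ((mul_le_mul_of_nonneg_left htot (by positivity)).trans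
      (mul_le_mul_of_nonneg_right hEr hpos))
  have h9 : 148 * (K:ℝ) ^ 2 * (4 * √ℓ) ≤ ℓ / 4 := by
    have := mul_le_mul_of_nonneg_right hsq (Real.sqrt_nonneg ℓ)
    rw [hss] at this
    linarith
  have h10 : 148 * (K:ℝ) ^ 2 * (300 * M) ≤ ℓ / 4 := by linarith
  rw [mul_add, mul_add, hlast] at h8
  linarith

lemma main3 (K : ℕ) (hK1 : 1 ≤ K) (X : ℝ) (h : 19 * K * Real.log (41 * K) ≤ X) :
    177600 * (K:ℝ) ^ 2 * ((2727936 * (K:ℝ) ^ 4) ^ (2 * K + 1) * 4 ^ K) ≤ Real.exp X := by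
  have hKr : (1:ℝ) ≤ K := by exact_mod_cast hK1
  set c : ℝ := 41 * K with hc
  have hc1 : 1 ≤ c := by linarith
  have e : Real.exp (19 * K * Real.log c) = c ^ (19 * K) := by
    rw [mul_comm, Real.exp_mul, Real.exp_log (by linarith)]
    exact_mod_cast Real.rpow_natCast c (19 * K)
  have h1 : 177600 * (K:ℝ) ^ 2 ≤ c ^ 6 := by
    have : c ^ 6 = 4750104241 * (K ^ 4 * K ^ 2) := by rw [hc]; ring
    rw [this]
    have h4 : (1:ℝ) ≤ K ^ 4 := one_le_pow₀ hKr
    have h2 : (1:ℝ) ≤ K ^ 2 := one_le_pow₀ hKr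
    nlinarith
  have h2 : 2727936 * (K:ℝ) ^ 4 ≤ c ^ 4 := by
    have : c ^ 4 = 2825761 * K ^ 4 := by rw [hc]; ring
    rw [this]
    have : (0:ℝ) ≤ K ^ 4 := by positivity
    linarith
  have h3 : (4:ℝ) ≤ c := by linarith
  calc 177600 * (K:ℝ) ^ 2 * ((2727936 * (K:ℝ) ^ 4) ^ (2 * K + 1) * 4 ^ K)
      ≤ c ^ 6 * ((c ^ 4) ^ (2 * K + 1) * c ^ K) := by gcongr
    _ = c ^ (6 + 4 * (2 * K + 1) + K) := by rw [← pow_mul, ← pow_add, ← pow_add, add_assoc]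
    _ ≤ c ^ (19 * K) := pow_le_pow_right₀ hc1 (by omega)
    _ = _ := e.symm
    _ ≤ _ := Real.exp_le_exp.mpr h

open Filter in
lemma asym (ε : ℝ) (h0 : 0 < ε) :
    ∀ᶠ X : ℝ in atTop, 38 * (Real.log 82 + Real.log X) ≤ X ^ ε := by
  have h1 := (isLittleO_log_rpow_atTop h0).bound (show (0:ℝ) < 1 / 76 by norm_num)
  have h2 := (tendsto_rpow_atTop h0).eventually_ge_atTop (76 * Real.log 82)
  filter_upwards [h1, h2, eventually_ge_atTop 1] with X a b c
  have : 0 ≤ X ^ ε := by positivity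
  rw [Real.norm_of_nonneg (Real.log_nonneg c), Real.norm_of_nonneg this] at a
  linarith

lemma final_half (ε : ℝ) (h0 : 0 < ε) (h1 : ε ≤ 1 / 2) : ∃ X₀ : ℝ, 1 ≤ X₀ ∧ ∀ X ≥ X₀, ∀ K : ℕ,
    (K:ℝ) ≤ X ^ (1 - ε) + 1 → 1 ≤ K → 19 * K * Real.log (41 * K) ≤ X := by
  obtain ⟨X₁, hX⟩ := Filter.eventually_atTop.mp (asym ε h0)
  refine ⟨max X₁ 1, le_max_right _ _, fun X hXX K hK hK1 => ?_⟩
  have hb := hX X ((le_max_left _ _).trans hXX)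
  have hX1 : 1 ≤ X := (le_max_right _ _).trans hXX
  have hKr : (1:ℝ) ≤ K := by exact_mod_cast hK1
  have a1 : 1 ≤ X ^ (1 - ε) := Real.one_le_rpow hX1 (by linarith)
  have a2 : (K:ℝ) ≤ 2 * X ^ (1 - ε) := by linarith
  have a3 : X ^ (1 - ε) ≤ X := by
    nth_rewrite 2 [← Real.rpow_one X]
    exact Real.rpow_le_rpow_of_exponent_le hX1 (by linarith)
  have a4 : Real.log (41 * K) ≤ Real.log 82 + Real.log X := by
    rw [← Real.log_mul (by norm_num) (by linarith)]
    exact Real.log_le_log (by linarith) (by linarith)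
  have a5 : 0 ≤ Real.log (41 * K) := Real.log_nonneg (by linarith)
  have a6 : X ^ (1 - ε) * X ^ ε = X := by
    rw [← Real.rpow_add (by linarith)]; simp
  calc 19 * K * Real.log (41 * K) ≤ 19 * (2 * X ^ (1 - ε)) * (Real.log 82 + Real.log X) := by gcongr
    _ = X ^ (1 - ε) * (38 * (Real.log 82 + Real.log X)) := by ring
    _ ≤ X ^ (1 - ε) * X ^ ε := by gcongr
    _ = X := a6

lemma final1 (ε : ℝ) (h0 : 0 < ε) : ∃ N₀ : ℕ, ∀ N : ℕ, N₀ ≤ N → ∀ A : Finset ℕ, A.card = N →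
      (Real.log (Real.log N)) ^ ((1 : ℝ) - ε) ≤
        (Set.ncard {t : ℝ | t ∈ Set.Icc 0 (2 * π) ∧ fA A t = 0} : ℝ) := by
  set δ := min ε (1/2) with hδ
  have d0 : 0 < δ := lt_min h0 (by norm_num)
  obtain ⟨X₀, hX₀, hX⟩ := final_half δ d0 (min_le_right _ _)
  refine ⟨⌈Real.exp (Real.exp X₀)⌉₊, fun N hN A hA => ?_⟩
  have hN1 : Real.exp (Real.exp X₀) ≤ N := (Nat.le_ceil _).trans (by exact_mod_cast hN)
  have hNp : (0:ℝ) < N := (Real.exp_pos _).trans_le hN1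
  have hl : Real.exp X₀ ≤ Real.log N := (Real.le_log_iff_exp_le hNp).mpr hN1
  have hlp : 0 < Real.log N := (Real.exp_pos _).trans_le hl
  have hXX : X₀ ≤ Real.log (Real.log N) := (Real.le_log_iff_exp_le hlp).mpr hl
  set X := Real.log (Real.log N) with hXd
  have hX1 : 1 ≤ X := hX₀.trans hXX
  have hAne : A.Nonempty := by
    rw [← Finset.card_pos, hA]; exact_mod_cast hNp
  have hfin := zeros_finite A hAne
  refine (Real.rpow_le_rpow_of_exponent_le hX1 (by linarith [min_le_left ε (1/2)] : 1 - ε ≤ 1 - δ)).trans ?_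
  by_contra hcon
  rw [not_le, Set.ncard_eq_toFinset_card _ hfin] at hcon
  set Z := hfin.toFinset with hZ
  have hp : 0 < X ^ (1 - δ) := by positivity
  set K := ⌈X ^ (1 - δ)⌉₊ with hK
  have hK1 : 1 ≤ K := Nat.ceil_pos.mpr hp
  have hZK : Z.card ≤ K := by
    have : (Z.card:ℝ) ≤ K := hcon.le.trans (Nat.le_ceil _)
    exact_mod_cast this
  have hq := main3 K hK1 X (hX X hXX K (Nat.ceil_lt_add_one hp.le).le hK1)
  rw [hXd, Real.exp_log hlp] at hq
  refine main2 A Z ?_ K hK1 hZK ?_ ?_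
  · intro t ht h
    rw [hZ, Set.Finite.mem_toFinset]; exact ⟨ht, h⟩
  · rw [hA]; exact (Real.one_le_exp (by linarith)).trans hl
  · rw [hA]; exact hq

end LZ

open Real

theorem littlewood_zeros_lower_bound :
    ∀ ε : ℝ, 0 < ε → ∃ N₀ : ℕ, ∀ N : ℕ, N₀ ≤ N → ∀ A : Finset ℕ, A.card = N →
      (Real.log (Real.log N)) ^ ((1 : ℝ) - ε) ≤
        (Set.ncard {t : ℝ | t ∈ Set.Icc 0 (2 * π) ∧
          ∑ n ∈ A, Real.cos (n * t) = 0} : ℝ) := by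
  intro ε hε
  exact LZ.final1 ε hε
end
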